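/- arXiv:2306.08950 — 4 statements merged into one kernel-verified Lean document; each statement's English description precedes it below -/
import Mathlib

section
/- Let q be a prime power, n = n_0 + ⋯ + n_l with each n_j ≥ 1, and γ_0,…,γ_l : 𝔽_q^× → ℂ^× group homomorphisms. Then (1/|GL_n(𝔽_q)|) · Σ_{g ∈ GL_n(𝔽_q)} R(γ_0,…,γ_l)(g) · R(γ_0^{−1},…,γ_l^{−1})(g) = 1 if and only if γ_i ≠ γ_j for all i ≠ j. (Equivalently, the Harish-Chandra induced character R(γ_0,…,γ_l) is irreducible if and only if the γ_j are pairwise distinct.) -/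
open Matrix

namespace QRep

open scoped Classical

/-- Apply a character `χ : 𝔽_q^× → ℂ^×` to a field element (0 outside the units). -/
noncomputable def χap {F : Type} [Field F] (χ : Fˣ →* ℂˣ) (d : F) : ℂ :=
  if h : d = 0 then 0 else χ (Units.mk0 d h)

/-- The determinant of the endomorphism induced by `T` on the subquotient `W / (U ∩ W)`
(defined to be `0` if `T` does not preserve `W` and `U`). -/
noncomputable def quotDet {F M : Type} [Field F] [AddCommGroup M] [Module F M]
    (T : M →ₗ[F] M) (W U : Submodule F M) : F :=
  if h : (∀ x ∈ W, T x ∈ W) ∧ (∀ x ∈ U, T x ∈ U) then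
    LinearMap.det (Submodule.mapQ (U.comap W.subtype) (U.comap W.subtype) (T.restrict h.1)
      (fun x hx => by
        simpa only [Submodule.mem_comap, LinearMap.restrict_apply, Submodule.subtype_apply]
          using h.2 x.1 hx))
  else 0

/-- The Harish-Chandra induced character of the linear character `γ` of the Levi
`GL_{n_0} × ⋯ × GL_{n_l}` of `GL_n(𝔽_q)`, evaluated at `g`: the sum over all `g`-stable
flags `𝔽_q^n = V_0 ⊇ V_1 ⊇ ⋯` with `dim V_j = β j`, of `∏_{j=0}^{l} γ_j(det(ḡ_j))`,
where `ḡ_j` is the automorphism induced by `g` on `V_j / V_{j+1}`. -/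
noncomputable def HC (F : Type) [Field F] (n l : ℕ) (β : ℕ → ℕ) (γ : ℕ → (Fˣ →* ℂˣ))
    (g : GL (Fin n) F) : ℂ :=
  ∑ᶠ V : {V : ℕ → Submodule F (Fin n → F) //
      V 0 = ⊤ ∧ (∀ j, V (j + 1) ≤ V j) ∧ (∀ j, Module.finrank F (V j) = β j) ∧
      (∀ j, ∀ v ∈ V j, Matrix.mulVecLin (g : Matrix (Fin n) (Fin n) F) v ∈ V j)},
    ∏ j ∈ Finset.range (l + 1),
      χap (γ j) (quotDet (Matrix.mulVecLin (g : Matrix (Fin n) (Fin n) F))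
        (V.1 j) (V.1 (j + 1)))

/-- The number of `m`-tuples of `n × n` matrices commuting with `g`; i.e. the character
of the conjugation action of `GL_n(𝔽_q)` on `𝔤𝔩_n(𝔽_q)^m`. -/
noncomputable def Λcount (F : Type) [Field F] (n m : ℕ) (g : GL (Fin n) F) : ℕ :=
  Nat.card {A : Fin m → Matrix (Fin n) (Fin n) F //
    ∀ r, (g : Matrix (Fin n) (Fin n) F) * A r = A r * (g : Matrix (Fin n) (Fin n) F)}


end QRep

namespace QRep

open scoped Classical

section Determinants

variable {F M : Type} [Field F] [AddCommGroup M] [Module F M]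

theorem χap_of_ne_zero (χ : Fˣ →* ℂˣ) {d : F} (h : d ≠ 0) : χap χ d = χ (Units.mk0 d h) :=
  dif_neg h

theorem χap_units (χ : Fˣ →* ℂˣ) (u : Fˣ) : χap χ u = χ u := by
  rw [χap_of_ne_zero χ u.ne_zero, Units.mk0_val]

theorem χap_one (χ : Fˣ →* ℂˣ) : χap χ (1 : F) = 1 := by
  simpa using χap_units χ 1

theorem χap_mul (χ : Fˣ →* ℂˣ) (a b : F) : χap χ (a * b) = χap χ a * χap χ b := by
  by_cases ha : a = 0
  · simp [χap, ha]
  by_cases hb : b = 0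
  · simp [χap, hb]
  lift a to Fˣ using IsUnit.mk0 a ha
  lift b to Fˣ using IsUnit.mk0 b hb
  rw [← Units.val_mul, χap_units, χap_units, χap_units, map_mul, Units.val_mul]

theorem χap_inv_char (χ : Fˣ →* ℂˣ) (a : F) : χap χ⁻¹ a = (χap χ a)⁻¹ := by
  by_cases ha : a = 0
  · simp [χap, ha]
  lift a to Fˣ using IsUnit.mk0 a ha
  simp [χap_units]

theorem χap_ne_zero (χ : Fˣ →* ℂˣ) {a : F} (ha : a ≠ 0) : χap χ a ≠ 0 := by
  rw [χap_of_ne_zero χ ha]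
  exact Units.ne_zero _

/-- The determinant of the restriction of `T` to a stable submodule `W`
(and `0` if `W` is not stable). -/
noncomputable def restrictDet (T : M →ₗ[F] M) (W : Submodule F M) : F :=
  if h : ∀ x ∈ W, T x ∈ W then LinearMap.det (T.restrict h) else 0

theorem restrictDet_eq (T : M →ₗ[F] M) {W : Submodule F M} (h : ∀ x ∈ W, T x ∈ W) :
    restrictDet T W = LinearMap.det (T.restrict h) :=
  dif_pos h

theorem restrictDet_one (W : Submodule F M) : restrictDet (1 : M →ₗ[F] M) W = 1 := by
  rw [restrictDet_eq _ (fun x hx => hx)]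
  exact LinearMap.det_id

theorem restrictDet_mul {S T : M →ₗ[F] M} {W : Submodule F M} (hS : ∀ x ∈ W, S x ∈ W)
    (hT : ∀ x ∈ W, T x ∈ W) :
    restrictDet (S * T) W = restrictDet S W * restrictDet T W := by
  rw [restrictDet_eq _ hS, restrictDet_eq _ hT,
    restrictDet_eq (S * T) (fun x hx => hS _ (hT x hx)), ← LinearMap.det_comp]
  rfl

theorem restrictDet_ne_zero [FiniteDimensional F M] {T : M →ₗ[F] M} (hT : Function.Injective T)
    {W : Submodule F M} (h : ∀ x ∈ W, T x ∈ W) : restrictDet T W ≠ 0 := by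
  rw [restrictDet_eq _ h]
  have hinj : LinearMap.ker (T.restrict h) = ⊥ := by
    rw [LinearMap.ker_eq_bot]
    intro x y hxy
    exact Subtype.ext (hT (congrArg Subtype.val hxy))
  exact (LinearEquiv.isUnit_det'
    (LinearEquiv.ofInjectiveEndo _ (LinearMap.ker_eq_bot.mp hinj))).ne_zero

theorem restrictDet_eq_mul_quotDet [FiniteDimensional F M] {T : M →ₗ[F] M} {W U : Submodule F M}
    (hUW : U ≤ W) (hW : ∀ x ∈ W, T x ∈ W) (hU : ∀ x ∈ U, T x ∈ U) :
    restrictDet T W = restrictDet T U * quotDet T W U := by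
  have hU' : U.comap W.subtype ≤ (U.comap W.subtype).comap (T.restrict hW) :=
    fun x hx => hU x.1 hx
  rw [restrictDet_eq _ hW, restrictDet_eq _ hU, quotDet, dif_pos ⟨hW, hU⟩,
    LinearMap.det_eq_det_mul_det (U.comap W.subtype) (T.restrict hW) hU']
  congr 1
  rw [← LinearMap.det_conj _ (Submodule.comapSubtypeEquivOfLe hUW)]
  congr 1

theorem quotDet_eq_div [FiniteDimensional F M] {T : M →ₗ[F] M} (hT : Function.Injective T)
    {W U : Submodule F M} (hUW : U ≤ W) (hW : ∀ x ∈ W, T x ∈ W) (hU : ∀ x ∈ U, T x ∈ U) :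
    quotDet T W U = restrictDet T W / restrictDet T U := by
  rw [restrictDet_eq_mul_quotDet hUW hW hU, mul_div_cancel_left₀ _ (restrictDet_ne_zero hT hU)]

theorem restrictDet_eq_smul [FiniteDimensional F M] {T : M →ₗ[F] M} {W U : Submodule F M}
    (hUW : U ≤ W) (hW : ∀ x ∈ W, T x ∈ W) (hU : ∀ x ∈ U, T x ∈ U)
    (hrank : Module.finrank F W = Module.finrank F U + 1) (c : F)
    (hc : ∀ x ∈ W, T x - c • x ∈ U) : restrictDet T W = restrictDet T U * c := by
  rw [restrictDet_eq_mul_quotDet hUW hW hU, quotDet, dif_pos ⟨hW, hU⟩]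
  congr 1
  have key : ∀ h, Submodule.mapQ (U.comap W.subtype) (U.comap W.subtype) (T.restrict hW) h =
      c • LinearMap.id := by
    intro h
    ext x
    simp only [LinearMap.comp_apply, Submodule.mapQ_apply, Submodule.mkQ_apply,
      LinearMap.smul_apply, LinearMap.id_apply]
    rw [← Submodule.Quotient.mk_smul, Submodule.Quotient.eq]
    exact hc x.1 x.2
  rw [key, LinearMap.det_smul, LinearMap.det_id, mul_one]
  have h1 := Submodule.finrank_quotient_add_finrank (U.comap W.subtype)
  rw [(Submodule.comapSubtypeEquivOfLe hUW).finrank_eq] at h1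
  rw [show Module.finrank F (W ⧸ U.comap W.subtype) = 1 by omega, pow_one]

theorem restrictDet_transvection_of_mem [FiniteDimensional F M] (f : Module.Dual F M) {v : M}
    {W : Submodule F M} (hv : v ∈ W) :
    restrictDet (LinearMap.transvection f v) W = 1 + f v := by
  have hW : ∀ x ∈ W, LinearMap.transvection f v x ∈ W := fun x hx => by
    rw [LinearMap.transvection.apply]
    exact W.add_mem hx (W.smul_mem _ hv)
  rw [restrictDet_eq _ hW]
  have : (LinearMap.transvection f v).restrict hW =
      LinearMap.transvection (f.comp W.subtype) ⟨v, hv⟩ := by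
    ext x
    simp [LinearMap.transvection.apply]
  rw [this, LinearMap.transvection.det]
  rfl

theorem restrictDet_transvection_of_le_ker (f : Module.Dual F M) (v : M)
    {W : Submodule F M} (hf : ∀ x ∈ W, f x = 0) :
    restrictDet (LinearMap.transvection f v) W = 1 := by
  have hW : ∀ x ∈ W, LinearMap.transvection f v x = x := fun x hx => by
    rw [LinearMap.transvection.apply, hf x hx, zero_smul, add_zero]
  rw [restrictDet_eq _ (fun x hx => by rwa [hW x hx])]
  convert LinearMap.det_id (A := F) (M := W)
  ext x
  exact hW x x.2

end Determinants

section Extension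

variable {F M N : Type} [Field F] [AddCommGroup M] [Module F M] [AddCommGroup N] [Module F N]
  [FiniteDimensional F M] [FiniteDimensional F N]

theorem exists_linearEquiv_extend (h : Module.finrank F M = Module.finrank F N)
    {A : Submodule F M} {A' : Submodule F N} (f : A ≃ₗ[F] A') :
    ∃ e : M ≃ₗ[F] N, ∀ x : A, e x = f x := by
  obtain ⟨C, hC⟩ := A.exists_isCompl
  obtain ⟨C', hC'⟩ := A'.exists_isCompl
  have hrank : Module.finrank F C = Module.finrank F C' := by
    have h1 := Submodule.finrank_add_eq_of_isCompl hC
    have h2 := Submodule.finrank_add_eq_of_isCompl hC'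
    have h3 := f.finrank_eq
    omega
  refine ⟨(Submodule.prodEquivOfIsCompl A C hC).symm ≪≫ₗ
    (f.prodCongr (LinearEquiv.ofFinrankEq C C' hrank)) ≪≫ₗ
      Submodule.prodEquivOfIsCompl A' C' hC', fun x => ?_⟩
  simp

theorem exists_linearEquiv_map_eq (h : M ≃ₗ[F] M) {A B B' : Submodule F M} (hAB : A ≤ B)
    (hAB' : A.map (h : M →ₗ[F] M) ≤ B') (hrank : Module.finrank F B = Module.finrank F B') :
    ∃ e : M ≃ₗ[F] M, (∀ x ∈ A, e x = h x) ∧ B.map (e : M →ₗ[F] M) = B' := by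
  obtain ⟨f, hf⟩ := exists_linearEquiv_extend hrank
    ((Submodule.comapSubtypeEquivOfLe hAB) ≪≫ₗ h.submoduleMap A ≪≫ₗ
      (Submodule.comapSubtypeEquivOfLe hAB').symm)
  obtain ⟨e, he⟩ := exists_linearEquiv_extend rfl f
  refine ⟨e, fun x hx => ?_, ?_⟩
  · have h1 := he ⟨x, hAB hx⟩
    have h2 := hf ⟨⟨x, hAB hx⟩, hx⟩
    simp only at h1
    rw [h1]
    simp only at h2
    rw [h2]
    rfl
  · apply le_antisymm
    · rintro _ ⟨x, hx, rfl⟩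
      have := he ⟨x, hx⟩
      simp only [LinearEquiv.coe_coe] at this ⊢
      rw [this]
      exact (f _).2
    · intro y hy
      refine ⟨f.symm ⟨y, hy⟩, (f.symm ⟨y, hy⟩).2, ?_⟩
      simp [he]

theorem exists_linearEquiv_flag {l : ℕ} {V W : ℕ → Submodule F M}
    (hV : ∀ j, V (j + 1) ≤ V j) (hW : ∀ j, W (j + 1) ≤ W j)
    (hrank : ∀ j, Module.finrank F (V j) = Module.finrank F (W j))
    (hl : ∀ j, l < j → V j = ⊥) :
    ∃ e : M ≃ₗ[F] M, ∀ j, (V j).map (e : M →ₗ[F] M) = W j := by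
  suffices ∀ d k, d + k = l + 1 → ∃ e : M ≃ₗ[F] M, ∀ j, k ≤ j → (V j).map (e : M →ₗ[F] M) = W j by
    obtain ⟨e, he⟩ := this (l + 1) 0 rfl
    exact ⟨e, fun j => he j j.zero_le⟩
  intro d
  induction d with
  | zero =>
    intro k hk
    refine ⟨LinearEquiv.refl F M, fun j hj => ?_⟩
    have h0 : V j = ⊥ := hl j (by omega)
    have h1 : W j = ⊥ := by
      rw [← Submodule.finrank_eq_zero (R := F), ← hrank, h0, finrank_bot]
    rw [h0, h1, Submodule.map_bot]
  | succ d ih =>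
    intro k hk
    obtain ⟨h, hh⟩ := ih (k + 1) (by omega)
    obtain ⟨e, he, heq⟩ := exists_linearEquiv_map_eq h (hV k)
      ((hh (k + 1) le_rfl).trans_le (hW k)) (hrank k)
    refine ⟨e, fun j hj => ?_⟩
    rcases hj.eq_or_lt with rfl | hj
    · exact heq
    · rw [← hh j hj]
      have hVj : V j ≤ V (k + 1) := antitone_nat_of_succ_le hV hj
      ext y
      simp only [Submodule.mem_map, LinearEquiv.coe_coe]
      exact exists_congr fun x => and_congr_right fun hx => by rw [he x (hVj hx)]

end Extension

section Flags

variable {F M : Type} [Field F] [AddCommGroup M] [Module F M]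

/-- `V` is a descending flag of subspaces starting at the whole space, with `dim V_j = β j`. -/
def IsFlag (β : ℕ → ℕ) (V : ℕ → Submodule F M) : Prop :=
  V 0 = ⊤ ∧ (∀ j, V (j + 1) ≤ V j) ∧ ∀ j, Module.finrank F (V j) = β j

/-- `T` preserves every member of the family `V`. -/
def Stabilizes (T : M →ₗ[F] M) (V : ℕ → Submodule F M) : Prop :=
  ∀ j, ∀ v ∈ V j, T v ∈ V j

/-- The value at `T` of the linear character attached to `γ` of the stabilizer of the flag `V`. -/
noncomputable def flagChar (l : ℕ) (γ : ℕ → (Fˣ →* ℂˣ)) (T : M →ₗ[F] M)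
    (V : ℕ → Submodule F M) : ℂ :=
  ∏ j ∈ Finset.range (l + 1), χap (γ j) (quotDet T (V j) (V (j + 1)))

theorem flagChar_inv (l : ℕ) (γ : ℕ → (Fˣ →* ℂˣ)) (T : M →ₗ[F] M) (V : ℕ → Submodule F M) :
    flagChar l (fun j => (γ j)⁻¹) T V = (flagChar l γ T V)⁻¹ := by
  simp only [flagChar, χap_inv_char, Finset.prod_inv_distrib]

theorem IsFlag.antitone {β : ℕ → ℕ} {V : ℕ → Submodule F M} (hV : IsFlag β V) : Antitone V :=
  antitone_nat_of_succ_le hV.2.1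

variable [FiniteDimensional F M]

theorem flagChar_one (l : ℕ) (γ : ℕ → (Fˣ →* ℂˣ)) {V : ℕ → Submodule F M}
    (hV : ∀ j, V (j + 1) ≤ V j) : flagChar l γ (1 : M →ₗ[F] M) V = 1 := by
  refine Finset.prod_eq_one fun j _ => ?_
  rw [quotDet_eq_div (fun _ _ h => h) (hV j) (fun _ h => h) (fun _ h => h), restrictDet_one,
    restrictDet_one, div_one, χap_one]

theorem flagChar_mul (l : ℕ) (γ : ℕ → (Fˣ →* ℂˣ)) {S T : M →ₗ[F] M}
    (hSinj : Function.Injective S) (hTinj : Function.Injective T) {V : ℕ → Submodule F M}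
    (hV : ∀ j, V (j + 1) ≤ V j) (hS : Stabilizes S V) (hT : Stabilizes T V) :
    flagChar l γ (S * T) V = flagChar l γ S V * flagChar l γ T V := by
  rw [flagChar, flagChar, flagChar, ← Finset.prod_mul_distrib]
  refine Finset.prod_congr rfl fun j _ => ?_
  rw [quotDet_eq_div hSinj (hV j) (hS _) (hS _), quotDet_eq_div hTinj (hV j) (hT _) (hT _),
    quotDet_eq_div (T := S * T) (hSinj.comp hTinj) (hV j) (fun x hx => hS _ _ (hT _ _ hx))
      (fun x hx => hS _ _ (hT _ _ hx)), restrictDet_mul (hS _) (hT _),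
    restrictDet_mul (hS _) (hT _), ← χap_mul, div_mul_div_comm]

theorem flagChar_ne_zero (l : ℕ) (γ : ℕ → (Fˣ →* ℂˣ)) {T : M →ₗ[F] M}
    (hTinj : Function.Injective T) {V : ℕ → Submodule F M}
    (hV : ∀ j, V (j + 1) ≤ V j) (hT : Stabilizes T V) : flagChar l γ T V ≠ 0 := by
  refine Finset.prod_ne_zero_iff.mpr fun j _ => χap_ne_zero _ ?_
  rw [quotDet_eq_div hTinj (hV j) (hT _) (hT _)]
  exact div_ne_zero (restrictDet_ne_zero hTinj (hT _)) (restrictDet_ne_zero hTinj (hT _))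

theorem IsFlag.eq_bot {β : ℕ → ℕ} {V : ℕ → Submodule F M} (hV : IsFlag β V) {j : ℕ}
    (hj : β j = 0) : V j = ⊥ := by
  rw [← Submodule.finrank_eq_zero (R := F), hV.2.2, hj]

/-- Two distinct flags have a nonzero off-diagonal piece in their common refinement. -/
theorem IsFlag.exists_mem_notMem_sup {β : ℕ → ℕ} {l : ℕ} (hβ : ∀ j, l < j → β j = 0)
    {V W : ℕ → Submodule F M} (hV : IsFlag β V) (hW : IsFlag β W) (hne : V ≠ W) :
    ∃ i ≤ l, ∃ k ≤ l, i ≠ k ∧ ∃ v ∈ V i, v ∈ W k ∧ v ∉ V (i + 1) ⊔ W (k + 1) := by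
  have hex : ∃ i, V i ≠ W i := by
    by_contra! h
    exact hne (funext h)
  obtain ⟨i, hi⟩ : ∃ i, Nat.find hex = i + 1 := by
    refine Nat.exists_eq_succ_of_ne_zero fun h => ?_
    have := Nat.find_spec hex
    rw [h, hV.1, hW.1] at this
    exact this rfl
  have hi1 : V (i + 1) ≠ W (i + 1) := hi ▸ Nat.find_spec hex
  have hi0 : V i = W i := not_not.mp (Nat.find_min hex (by omega))
  have hil : i + 1 ≤ l := by
    by_contra! h
    exact hi1 (by rw [hV.eq_bot (hβ _ h), hW.eq_bot (hβ _ h)])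
  have hnle : ¬ W (i + 1) ≤ V (i + 1) := fun h =>
    hi1 (Submodule.eq_of_le_of_finrank_eq h (by rw [hV.2.2, hW.2.2])).symm
  let P : ℕ → Prop := fun k => ∃ w ∈ V i, w ∈ W k ∧ w ∉ V (i + 1)
  have hP : ∀ k, P k → k ≤ l := by
    rintro k ⟨w, -, hw, hw'⟩
    by_contra! h
    rw [hW.eq_bot (hβ _ h), Submodule.mem_bot] at hw
    exact hw' (hw ▸ zero_mem _)
  have hPi : P (i + 1) := by
    obtain ⟨w, hw, hw'⟩ := Set.not_subset.mp hnle
    exact ⟨w, hi0 ▸ hW.2.1 i hw, hw, hw'⟩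
  obtain ⟨w, hwV, hwW, hw⟩ : P (Nat.findGreatest P l) := Nat.findGreatest_spec hil hPi
  have hik : i + 1 ≤ Nat.findGreatest P l := Nat.le_findGreatest hil hPi
  refine ⟨i, by omega, Nat.findGreatest P l, Nat.findGreatest_le l, by omega, w, hwV, hwW,
    fun hmem => ?_⟩
  obtain ⟨a, ha, b, hb, rfl⟩ := Submodule.mem_sup.mp hmem
  have hbV : b ∈ V (i + 1) := by
    by_contra hb'
    have hbi : b ∈ V i := (Submodule.add_mem_iff_right _ (hV.2.1 i ha)).mp hwV
    have hPk : P (Nat.findGreatest P l + 1) := ⟨b, hbi, hb, hb'⟩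
    have := Nat.le_findGreatest (hP _ hPk) hPk
    omega
  exact hw (add_mem ha hbV)

theorem flagChar_transvection {l i : ℕ} (hi : i ≤ l) (γ : ℕ → (Fˣ →* ℂˣ))
    {V : ℕ → Submodule F M} (hV : Antitone V) {f : Module.Dual F M} {v : M} (hv : v ∈ V i)
    (hf : ∀ x ∈ V (i + 1), f x = 0) (u : Fˣ) (hu : 1 + f v = u) :
    Stabilizes (LinearMap.transvection f v) V ∧
      flagChar l γ (LinearMap.transvection f v) V = γ i u := by
  have hfix : ∀ j, ¬ j ≤ i → ∀ x ∈ V j, f x = 0 := fun j hj x hx => hf x (hV (by omega) hx)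
  have hst : Stabilizes (LinearMap.transvection f v) V := by
    intro j x hx
    rw [LinearMap.transvection.apply]
    by_cases hj : j ≤ i
    · exact add_mem hx (Submodule.smul_mem _ _ (hV hj hv))
    · rwa [hfix j hj x hx, zero_smul, add_zero]
  have hinj : Function.Injective (LinearMap.transvection f v) := by
    have hdet : IsUnit (LinearMap.det (LinearMap.transvection f v)) := by
      rw [LinearMap.transvection.det, hu]
      exact u.isUnit
    exact (LinearMap.equivOfDetNeZero _ hdet.ne_zero).injective
  have hdet : ∀ j, restrictDet (LinearMap.transvection f v) (V j) =
      if j ≤ i then (u : F) else 1 := by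
    intro j
    split_ifs with hj
    · rw [restrictDet_transvection_of_mem f (hV hj hv), hu]
    · exact restrictDet_transvection_of_le_ker f v (hfix j hj)
  refine ⟨hst, ?_⟩
  rw [flagChar, Finset.prod_eq_single_of_mem i (Finset.mem_range.mpr (by omega))]
  · rw [quotDet_eq_div hinj (hV i.le_succ) (hst _) (hst _), hdet, hdet, if_pos le_rfl,
      if_neg (by omega), div_one, χap_units]
  · intro j _ hj
    rw [quotDet_eq_div hinj (hV j.le_succ) (hst _) (hst _), hdet, hdet]
    by_cases hji : j ≤ i
    · rw [if_pos hji, if_pos (by omega), div_self u.ne_zero, χap_one]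
    · rw [if_neg hji, if_neg (by omega), div_one, χap_one]

theorem IsFlag.exists_flagChar_ne {β : ℕ → ℕ} {l : ℕ} (hβ : ∀ j, l < j → β j = 0)
    {V W : ℕ → Submodule F M} (hV : IsFlag β V) (hW : IsFlag β W) (hne : V ≠ W)
    {γ : ℕ → (Fˣ →* ℂˣ)} (hγ : ∀ i ≤ l, ∀ j ≤ l, i ≠ j → γ i ≠ γ j) :
    ∃ T : M ≃ₗ[F] M, Stabilizes (T : M →ₗ[F] M) V ∧ Stabilizes (T : M →ₗ[F] M) W ∧
      flagChar l γ (T : M →ₗ[F] M) V ≠ flagChar l γ (T : M →ₗ[F] M) W := by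
  obtain ⟨i, hi, k, hk, hik, v, hvV, hvW, hv⟩ := hV.exists_mem_notMem_sup hβ hW hne
  obtain ⟨u, hu⟩ := DFunLike.ne_iff.mp (hγ i hi k hk hik)
  obtain ⟨f, hfv, hf⟩ := Submodule.exists_le_ker_of_notMem hv
  have huv : 1 + f (((u - 1 : F) / f v) • v) = u := by
    rw [map_smul, smul_eq_mul, div_mul_cancel₀ _ hfv, add_sub_cancel]
  have h1 := flagChar_transvection hi γ hV.antitone (f := f) (Submodule.smul_mem _ _ hvV)
    (fun x hx => hf (Submodule.mem_sup_left hx)) u huv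
  have h2 := flagChar_transvection hk γ hW.antitone (f := f) (Submodule.smul_mem _ _ hvW)
    (fun x hx => hf (Submodule.mem_sup_right hx)) u huv
  have hdet : LinearMap.det (LinearMap.transvection f (((u - 1 : F) / f v) • v)) ≠ 0 := by
    rw [LinearMap.transvection.det, huv]
    exact u.ne_zero
  refine ⟨LinearMap.equivOfDetNeZero _ hdet, h1.1, h2.1, ?_⟩
  change flagChar l γ (LinearMap.transvection f _) V ≠ flagChar l γ (LinearMap.transvection f _) W
  rw [h1.2, h2.2]
  exact fun h => hu (Units.ext h)

theorem flagChar_eq_of_restrictDet {l i j : ℕ} (hij : i < j) (hj : j ≤ l) {γ : ℕ → (Fˣ →* ℂˣ)}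
    (hγ : γ i = γ j) {V W : ℕ → Submodule F M} (hV : ∀ k, V (k + 1) ≤ V k)
    (hW : ∀ k, W (k + 1) ≤ W k) {T : M →ₗ[F] M} (hT : Function.Injective T)
    (hTV : Stabilizes T V) (hTW : Stabilizes T W) {r : F} (hr : r ≠ 0)
    (hVW : ∀ k, restrictDet T (V k) = (if i < k ∧ k ≤ j then r else 1) * restrictDet T (W k)) :
    flagChar l γ T V = flagChar l γ T W := by
  have hfac : ∀ k, χap (γ k) (quotDet T (V k) (V (k + 1))) =
      χap (γ k) ((if i < k ∧ k ≤ j then r else 1) / (if i < k + 1 ∧ k + 1 ≤ j then r else 1)) *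
        χap (γ k) (quotDet T (W k) (W (k + 1))) := by
    intro k
    rw [quotDet_eq_div hT (hV k) (hTV _) (hTV _), quotDet_eq_div hT (hW k) (hTW _) (hTW _), hVW,
      hVW, ← χap_mul, div_mul_div_comm]
  rw [flagChar, flagChar, Finset.prod_congr rfl fun k _ => hfac k, Finset.prod_mul_distrib]
  convert one_mul _
  rw [Finset.prod_eq_mul i j hij.ne]
  · rw [if_neg (by omega), if_pos (by omega), if_pos (by omega), if_neg (by omega), hγ, ← χap_mul,
      div_one, one_div, inv_mul_cancel₀ hr, χap_one]
  · intro k _ hk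
    by_cases h : i < k ∧ k ≤ j
    · rw [if_pos h, if_pos (by omega), div_self hr, χap_one]
    · rw [if_neg h, if_neg (by omega), div_one, χap_one]
  · intro h
    exact absurd (Finset.mem_range.mpr (by omega)) h
  · intro h
    exact absurd (Finset.mem_range.mpr (by omega)) h

end Flags

section CoordinateFlags

variable {F : Type} [Field F] {n : ℕ}

/-- The flag of coordinate subspaces cut out by the permuted index sets `{c | σ c < β j}`. -/
noncomputable def coordFlag (F : Type) [Field F] {n : ℕ} (β : ℕ → ℕ)
    (σ : Equiv.Perm (Fin n)) (j : ℕ) : Submodule F (Fin n → F) :=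
  Pi.spanSubset F {c | (σ c : ℕ) < β j}

theorem mem_coordFlag {β : ℕ → ℕ} {σ : Equiv.Perm (Fin n)} {j : ℕ} {v : Fin n → F} :
    v ∈ coordFlag F β σ j ↔ ∀ c, β j ≤ σ c → v c = 0 := by
  simp [coordFlag, Pi.mem_spanSubset_iff]

theorem isFlag_coordFlag {β : ℕ → ℕ} (hβ : Antitone β) (σ : Equiv.Perm (Fin (β 0))) :
    IsFlag β (coordFlag F β σ) := by
  refine ⟨?_, fun j v hv => ?_, fun j => ?_⟩
  · ext v
    simp only [mem_coordFlag, Submodule.mem_top, iff_true]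
    intro c hc
    have := (σ c).2
    omega
  · rw [mem_coordFlag] at hv ⊢
    exact fun c hc => hv c ((hβ j.le_succ).trans hc)
  · rw [coordFlag, Pi.dim_spanSubset]
    have h1 : {c | (σ c : ℕ) < β j} = σ ⁻¹' {c | (c : ℕ) < β j} := rfl
    rw [h1, Set.ncard_preimage_of_injective_subset_range σ.injective (by simp)]
    have h2 : {c : Fin (β 0) | (c : ℕ) < β j} = Set.range (Fin.castLE (hβ j.zero_le)) := by
      ext c
      simp only [Set.mem_ofPred_eq, Set.mem_range]
      exact ⟨fun h => ⟨⟨c, h⟩, rfl⟩, by rintro ⟨d, rfl⟩; exact d.2⟩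
    rw [h2, Set.ncard_range_of_injective (Fin.castLE_injective _), Nat.card_fin]

theorem restrictDet_spanSubset_insert {s : Set (Fin n)} {b : Fin n} (hb : b ∉ s)
    {T : (Fin n → F) →ₗ[F] (Fin n → F)}
    (hT : ∀ x ∈ Pi.spanSubset F (insert b s), T x ∈ Pi.spanSubset F (insert b s))
    (hTs : ∀ x ∈ Pi.spanSubset F s, T x ∈ Pi.spanSubset F s) (c : F)
    (hc : T (Pi.single b 1) - c • Pi.single b 1 ∈ Pi.spanSubset F s) :
    restrictDet T (Pi.spanSubset F (insert b s)) = restrictDet T (Pi.spanSubset F s) * c := by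
  refine restrictDet_eq_smul (fun x hx => ?_) hT hTs ?_ c fun x hx => ?_
  · rw [Pi.mem_spanSubset_iff] at hx ⊢
    exact fun d hd => hx d fun h => hd (Set.mem_insert_of_mem b h)
  · rw [Pi.dim_spanSubset, Pi.dim_spanSubset, Set.ncard_insert_of_notMem hb]
  · have hu : x - x b • Pi.single b 1 ∈ Pi.spanSubset F s := by
      rw [Pi.mem_spanSubset_iff] at hx ⊢
      intro d hd
      by_cases hdb : d = b
      · subst hdb
        simp
      · simp [hdb, hx d (by simp [hdb, hd])]
    have hsum := add_mem (Submodule.smul_mem _ (x b) hc)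
      (sub_mem (hTs _ hu) (Submodule.smul_mem _ c hu))
    convert hsum using 1
    rw [map_sub, map_smul]
    module

theorem exists_flag_pair_flagChar_eq {β : ℕ → ℕ} (hβ : Antitone β) {l i j : ℕ} (hij : i < j)
    (hj : j ≤ l) (hβi : β (i + 1) < β i) (hβj : β (j + 1) < β j) {γ : ℕ → (Fˣ →* ℂˣ)}
    (hγ : γ i = γ j) :
    ∃ V W : ℕ → Submodule F (Fin (β 0) → F), IsFlag β V ∧ IsFlag β W ∧ V ≠ W ∧
      ∀ T : (Fin (β 0) → F) →ₗ[F] (Fin (β 0) → F), Function.Injective T →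
        Stabilizes T V → Stabilizes T W → flagChar l γ T V = flagChar l γ T W := by
  obtain ⟨a, ha⟩ : ∃ a : Fin (β 0), (a : ℕ) = β (i + 1) :=
    ⟨⟨β (i + 1), hβi.trans_le (hβ i.zero_le)⟩, rfl⟩
  obtain ⟨b, hb⟩ : ∃ b : Fin (β 0), (b : ℕ) = β (j + 1) :=
    ⟨⟨β (j + 1), hβj.trans_le (hβ j.zero_le)⟩, rfl⟩
  have hba : (b : ℕ) < a := by
    rw [ha, hb]
    exact hβj.trans_le (hβ hij)
  have hmid : ∀ k, i < k → k ≤ j → (b : ℕ) < β k ∧ β k ≤ a := fun k h1 h2 =>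
    ⟨hb ▸ hβj.trans_le (hβ h2), ha ▸ hβ h1⟩
  have hswap : ∀ c, Equiv.swap a b c = if c = a then b else if c = b then a else c :=
    Equiv.swap_apply_def a b
  let s : ℕ → Set (Fin (β 0)) := fun k => {c | (c : ℕ) < β k ∧ c ≠ b}
  have hbs : ∀ k, b ∉ s k := fun k h => h.2 rfl
  have has : ∀ k, i < k → k ≤ j → a ∉ s k := fun k h1 h2 h => by
    have := (hmid k h1 h2).2
    have := h.1
    omega
  have hVs : ∀ k, i < k → k ≤ j →
      coordFlag F β (1 : Equiv.Perm (Fin (β 0))) k = Pi.spanSubset F (insert b (s k)) := by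
    intro k h1 h2
    have := hmid k h1 h2
    rw [coordFlag]
    congr 1
    ext c
    simp only [s, Set.mem_ofPred_eq, Set.mem_insert_iff, Equiv.Perm.one_apply, ne_eq]
    by_cases hcb : c = b
    · simp [hcb, this.1]
    · simp [hcb]
  have hWs : ∀ k, i < k → k ≤ j →
      coordFlag F β (Equiv.swap a b) k = Pi.spanSubset F (insert a (s k)) := by
    intro k h1 h2
    have := hmid k h1 h2
    rw [coordFlag]
    congr 1
    ext c
    simp only [s, Set.mem_ofPred_eq, Set.mem_insert_iff, hswap, ne_eq]
    by_cases hca : c = a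
    · simp [hca, this.1]
    by_cases hcb : c = b
    · subst hcb
      simpa [hca] using this.2
    · simp [hca, hcb]
  have hout : ∀ k, ¬(i < k ∧ k ≤ j) →
      coordFlag F β (1 : Equiv.Perm (Fin (β 0))) k = coordFlag F β (Equiv.swap a b) k := by
    intro k hk
    have hab : ((a : ℕ) < β k ↔ (b : ℕ) < β k) := by
      by_cases hki : k ≤ i
      · have := hβ hki
        omega
      · have := hβ (show j + 1 ≤ k by omega)
        omega
    rw [coordFlag, coordFlag]
    congr 1
    ext c
    simp only [Set.mem_ofPred_eq, hswap, Equiv.Perm.one_apply]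
    by_cases hca : c = a
    · simp [hca, hab]
    by_cases hcb : c = b
    · subst hcb
      simp [hca, hab]
    · simp [hca, hcb]
  refine ⟨coordFlag F β 1, coordFlag F β (Equiv.swap a b), isFlag_coordFlag hβ _,
    isFlag_coordFlag hβ _, fun h => ?_, fun T hT hTV hTW => ?_⟩
  · have hmem : (Pi.single a 1 : Fin (β 0) → F) ∈ coordFlag F β (Equiv.swap a b) j := by
      rw [hWs j hij le_rfl, Pi.mem_spanSubset_iff]
      intro c hc
      simp only [Set.mem_insert_iff, not_or] at hc
      simp [hc.1]
    rw [← h, mem_coordFlag] at hmem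
    simpa using hmem a (hmid j hij le_rfl).2
  have hsle : ∀ k, k ≤ j → s j ⊆ s k := fun k hk c hc => ⟨hc.1.trans_le (hβ hk), hc.2⟩
  have hTs : ∀ k, i < k → k ≤ j → ∀ x ∈ Pi.spanSubset F (s k), T x ∈ Pi.spanSubset F (s k) := by
    intro k h1 h2 x hx
    have hV := hTV k x
    have hW := hTW k x
    rw [hVs k h1 h2] at hV
    rw [hWs k h1 h2] at hW
    simp only [Pi.mem_spanSubset_iff, Set.mem_insert_iff, not_or] at hV hW hx ⊢
    intro c hc
    by_cases hcb : c = b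
    · exact hW (fun d hd => hx d hd.2) c ⟨by rintro rfl; omega, hc⟩
    · exact hV (fun d hd => hx d hd.2) c ⟨hcb, hc⟩
  have hcol : ∀ d : Fin (β 0), (∀ x ∈ Pi.spanSubset F (insert d (s j)),
        T x ∈ Pi.spanSubset F (insert d (s j))) → ∀ k, k ≤ j →
      T (Pi.single d 1) - T (Pi.single d 1) d • Pi.single d 1 ∈ Pi.spanSubset F (s k) := by
    intro d hd k hk
    have hmem : T (Pi.single d 1) ∈ Pi.spanSubset F (insert d (s j)) := by
      refine hd _ (Pi.mem_spanSubset_iff.mpr fun c hc => ?_)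
      simp only [Set.mem_insert_iff, not_or] at hc
      simp [hc.1]
    rw [Pi.mem_spanSubset_iff] at hmem ⊢
    intro c hc
    by_cases hcd : c = d
    · subst hcd
      simp
    · simp [hcd, hmem c (by simpa [hcd] using fun h => hc (hsle k hk h))]
  have hstV : ∀ k, i < k → k ≤ j → ∀ x ∈ Pi.spanSubset F (insert b (s k)),
      T x ∈ Pi.spanSubset F (insert b (s k)) := fun k h1 h2 => hVs k h1 h2 ▸ hTV k
  have hstW : ∀ k, i < k → k ≤ j → ∀ x ∈ Pi.spanSubset F (insert a (s k)),
      T x ∈ Pi.spanSubset F (insert a (s k)) := fun k h1 h2 => hWs k h1 h2 ▸ hTW k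
  have hdV : ∀ k, i < k → k ≤ j → restrictDet T (coordFlag F β (1 : Equiv.Perm (Fin (β 0))) k) =
      restrictDet T (Pi.spanSubset F (s k)) * T (Pi.single b 1) b := fun k h1 h2 => by
    rw [hVs k h1 h2]
    exact restrictDet_spanSubset_insert (hbs k) (hstV k h1 h2) (hTs k h1 h2) _
      (hcol b (hstV j hij le_rfl) k h2)
  have hdW : ∀ k, i < k → k ≤ j → restrictDet T (coordFlag F β (Equiv.swap a b) k) =
      restrictDet T (Pi.spanSubset F (s k)) * T (Pi.single a 1) a := fun k h1 h2 => by
    rw [hWs k h1 h2]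
    exact restrictDet_spanSubset_insert (has k h1 h2) (hstW k h1 h2) (hTs k h1 h2) _
      (hcol a (hstW j hij le_rfl) k h2)
  have hμ : T (Pi.single b 1) b ≠ 0 :=
    right_ne_zero_of_mul (hdV j hij le_rfl ▸ restrictDet_ne_zero hT (hTV j))
  have hν : T (Pi.single a 1) a ≠ 0 :=
    right_ne_zero_of_mul (hdW j hij le_rfl ▸ restrictDet_ne_zero hT (hTW j))
  refine flagChar_eq_of_restrictDet hij hj hγ (isFlag_coordFlag hβ _).2.1
    (isFlag_coordFlag hβ _).2.1 hT hTV hTW (div_ne_zero hμ hν) fun k => ?_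
  split_ifs with hk
  · rw [hdV k hk.1 hk.2, hdW k hk.1 hk.2]
    field_simp
  · rw [hout k hk, one_mul]

end CoordinateFlags

section Counting

variable {F : Type} [Field F] {n : ℕ}

/-- The endomorphism of `F^n` given by an invertible matrix. -/
noncomputable abbrev glEnd (g : GL (Fin n) F) : (Fin n → F) →ₗ[F] (Fin n → F) :=
  Matrix.mulVecLin (g : Matrix (Fin n) (Fin n) F)

theorem glEnd_one : glEnd (1 : GL (Fin n) F) = 1 := Matrix.mulVecLin_one

theorem glEnd_mul (g h : GL (Fin n) F) : glEnd (g * h) = glEnd g * glEnd h :=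
  Matrix.mulVecLin_mul _ _

theorem glEnd_injective (g : GL (Fin n) F) : Function.Injective (glEnd g) := by
  refine Function.LeftInverse.injective (g := glEnd g⁻¹) fun x => ?_
  rw [← Module.End.mul_apply, ← glEnd_mul, inv_mul_cancel, glEnd_one, Module.End.one_apply]

theorem exists_glEnd_eq (e : (Fin n → F) ≃ₗ[F] (Fin n → F)) :
    ∃ g : GL (Fin n) F, glEnd g = (e : (Fin n → F) →ₗ[F] (Fin n → F)) := by
  refine ⟨Matrix.GeneralLinearGroup.toLin.symm (LinearMap.GeneralLinearGroup.ofLinearEquiv e), ?_⟩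
  rw [glEnd, ← Matrix.GeneralLinearGroup.coe_toLin, MulEquiv.apply_symm_apply]
  rfl

theorem finrank_map_glEnd (g : GL (Fin n) F) (S : Submodule F (Fin n → F)) :
    Module.finrank F (S.map (glEnd g)) = Module.finrank F S :=
  (Submodule.equivMapOfInjective _ (glEnd_injective g) S).finrank_eq.symm

theorem stabilizes_iff_map_eq {g : GL (Fin n) F} {V : ℕ → Submodule F (Fin n → F)} :
    Stabilizes (glEnd g) V ↔ ∀ j, (V j).map (glEnd g) = V j := by
  refine ⟨fun h j => ?_, fun h j v hv => ?_⟩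
  · refine Submodule.eq_of_le_of_finrank_eq (Submodule.map_le_iff_le_comap.mpr (h j)) ?_
    exact finrank_map_glEnd g _
  · rw [← h j]
    exact Submodule.mem_map_of_mem hv

/-- The stabilizer of a family of subspaces in `GL_n(F)`. -/
def flagStabilizer (V : ℕ → Submodule F (Fin n → F)) : Subgroup (GL (Fin n) F) where
  carrier := {g | Stabilizes (glEnd g) V}
  mul_mem' {g h} hg hh j v hv := by
    rw [glEnd_mul]
    exact hg j _ (hh j v hv)
  one_mem' j v hv := by rwa [glEnd_one]
  inv_mem' {g} hg := by
    intro j v hv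
    obtain ⟨w, hw, rfl⟩ := (stabilizes_iff_map_eq.mp hg j).symm ▸ hv
    rwa [← Module.End.mul_apply, ← glEnd_mul, inv_mul_cancel, glEnd_one]

theorem mem_flagStabilizer {V : ℕ → Submodule F (Fin n → F)} {g : GL (Fin n) F} :
    g ∈ flagStabilizer V ↔ Stabilizes (glEnd g) V :=
  Iff.rfl

/-- The linear character of the stabilizer of a flag attached to `γ`. -/
noncomputable def stabilizerChar (l : ℕ) (γ : ℕ → (Fˣ →* ℂˣ)) {V : ℕ → Submodule F (Fin n → F)}
    (hV : ∀ j, V (j + 1) ≤ V j) : flagStabilizer V →* ℂ where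
  toFun g := flagChar l γ (glEnd g.1) V
  map_one' := by
    rw [Subgroup.coe_one, glEnd_one, flagChar_one l γ hV]
  map_mul' g h := by
    rw [Subgroup.coe_mul, glEnd_mul,
      flagChar_mul l γ (glEnd_injective _) (glEnd_injective _) hV g.2 h.2]

/-- The flags of `F^n` with dimensions `β`. -/
abbrev Flag (F : Type) [Field F] (n : ℕ) (β : ℕ → ℕ) : Type :=
  {V : ℕ → Submodule F (Fin n → F) // IsFlag β V}

theorem HC_eq_sum {β : ℕ → ℕ} [Fintype (Flag F n β)] (l : ℕ) (γ : ℕ → (Fˣ →* ℂˣ))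
    (g : GL (Fin n) F) :
    HC F n l β γ g =
      ∑ V : Flag F n β, if g ∈ flagStabilizer V.1 then flagChar l γ (glEnd g) V.1 else 0 := by
  rw [← Finset.sum_filter, Finset.sum_subtype (p := fun V => g ∈ flagStabilizer V.1) _
    (fun V => by simp), ← finsum_eq_sum_of_fintype]
  refine finsum_eq_of_bijective
    (fun V => ⟨⟨V.1, V.2.1, V.2.2.1, V.2.2.2.1⟩, V.2.2.2.2⟩) ⟨fun V W h => ?_, ?_⟩ fun V => rfl
  · exact Subtype.ext (congrArg (fun x => x.1.1) h)
  · rintro ⟨⟨V, h⟩, hg⟩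
    exact ⟨⟨V, h.1, h.2.1, h.2.2, hg⟩, rfl⟩

variable [Fintype F]

theorem sum_flagChar_mul_inv (l : ℕ) (γ : ℕ → (Fˣ →* ℂˣ)) {V W : ℕ → Submodule F (Fin n → F)}
    (hV : ∀ j, V (j + 1) ≤ V j) (hW : ∀ j, W (j + 1) ≤ W j) :
    (∑ g : GL (Fin n) F, if g ∈ flagStabilizer V ⊓ flagStabilizer W then
        flagChar l γ (glEnd g) V * (flagChar l γ (glEnd g) W)⁻¹ else 0) =
      if ∀ g ∈ flagStabilizer V ⊓ flagStabilizer W,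
          flagChar l γ (glEnd g) V = flagChar l γ (glEnd g) W then
        (Nat.card ↥(flagStabilizer V ⊓ flagStabilizer W) : ℂ) else 0 := by
  let ψ : ↥(flagStabilizer V ⊓ flagStabilizer W) →* ℂ :=
    (stabilizerChar l γ hV).comp (Subgroup.inclusion inf_le_left) *
      (stabilizerChar l (fun j => (γ j)⁻¹) hW).comp (Subgroup.inclusion inf_le_right)
  have hψ : ∀ g, ψ g = flagChar l γ (glEnd g.1) V * (flagChar l γ (glEnd g.1) W)⁻¹ := fun g => by
    rw [← flagChar_inv]
    rfl
  have hiff : ψ = 1 ↔ ∀ g ∈ flagStabilizer V ⊓ flagStabilizer W,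
      flagChar l γ (glEnd g) V = flagChar l γ (glEnd g) W := by
    rw [DFunLike.ext_iff, Subtype.forall]
    refine forall₂_congr fun g hg => ?_
    rw [hψ, MonoidHom.one_apply,
      mul_inv_eq_one₀ (flagChar_ne_zero l γ (glEnd_injective g) hW hg.2)]
  rw [← Finset.sum_filter, Finset.sum_subtype (p := (· ∈ flagStabilizer V ⊓ flagStabilizer W)) _
    (fun g => by simp), ← Fintype.sum_congr _ _ hψ, sum_hom_units ψ, Nat.card_eq_fintype_card]
  simp only [hiff]
  push_cast
  rfl

theorem finite_flag {β : ℕ → ℕ} {l : ℕ} (hβ : ∀ j, l < j → β j = 0) : Finite (Flag F n β) := by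
  refine Finite.of_injective (β := Fin (l + 1) → Submodule F (Fin n → F))
    (fun V j => V.1 j) fun V W h => Subtype.ext (funext fun j => ?_)
  by_cases hj : j ≤ l
  · exact congrFun h ⟨j, by omega⟩
  · rw [V.2.eq_bot (hβ j (by omega)), W.2.eq_bot (hβ j (by omega))]

theorem sum_card_flagStabilizer {β : ℕ → ℕ} [Fintype (Flag F n β)] {l : ℕ}
    (hβ : ∀ j, l < j → β j = 0) (V₀ : Flag F n β) :
    ∑ V : Flag F n β, Nat.card (flagStabilizer V.1) = Nat.card (GL (Fin n) F) := by
  have htrans : ∀ V : Flag F n β, ∃ h : GL (Fin n) F, ∀ j, (V₀.1 j).map (glEnd h) = V.1 j := by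
    intro V
    obtain ⟨e, he⟩ := exists_linearEquiv_flag V₀.2.2.1 V.2.2.1
      (fun j => by rw [V₀.2.2.2, V.2.2.2]) (fun j hj => V₀.2.eq_bot (hβ j hj))
    obtain ⟨h, hh⟩ := exists_glEnd_eq e
    exact ⟨h, fun j => by rw [hh, he]⟩
  choose h hh using htrans
  have hmap : ∀ (a b : GL (Fin n) F) (S : Submodule F (Fin n → F)),
      S.map (glEnd (a * b)) = (S.map (glEnd b)).map (glEnd a) := fun a b S => by
    rw [glEnd_mul, ← Submodule.map_comp]
    rfl
  rw [← Nat.card_sigma]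
  refine Nat.card_eq_of_bijective
    (fun x : (V : Flag F n β) × flagStabilizer V.1 => (x.2 : GL (Fin n) F) * h x.1) ⟨?_, ?_⟩
  · rintro ⟨V, a, ha⟩ ⟨W, b, hb⟩ hab
    have hVW : V = W := by
      refine Subtype.ext (funext fun j => ?_)
      have h1 := hmap a (h V) (V₀.1 j)
      have h2 := hmap b (h W) (V₀.1 j)
      rw [hh, stabilizes_iff_map_eq.mp ha] at h1
      rw [hh, stabilizes_iff_map_eq.mp hb] at h2
      rw [← h1, ← h2]
      exact congrArg (fun g => (V₀.1 j).map (glEnd g)) hab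
    subst hVW
    have : a = b := mul_right_cancel hab
    subst this
    rfl
  · intro g
    have hflag : IsFlag β fun j => (V₀.1 j).map (glEnd g) := by
      refine ⟨?_, fun j => Submodule.map_mono (V₀.2.2.1 j), fun j => ?_⟩
      · refine Submodule.eq_top_of_finrank_eq ?_
        rw [finrank_map_glEnd, V₀.2.1, finrank_top]
      · rw [finrank_map_glEnd, V₀.2.2.2]
    refine ⟨⟨⟨_, hflag⟩, g * (h ⟨_, hflag⟩)⁻¹, ?_⟩, inv_mul_cancel_right _ _⟩
    rw [mem_flagStabilizer, stabilizes_iff_map_eq]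
    intro j
    have := hh ⟨_, hflag⟩ j
    simp only at this ⊢
    conv_lhs => rw [← this]
    rw [← hmap, inv_mul_cancel_right]

theorem sum_HC_mul_HC_inv {β : ℕ → ℕ} [Fintype (Flag F n β)] (l : ℕ) (γ : ℕ → (Fˣ →* ℂˣ)) :
    ∑ g : GL (Fin n) F, HC F n l β γ g * HC F n l β (fun j => (γ j)⁻¹) g =
      ((∑ V : Flag F n β, ∑ W : Flag F n β,
        if ∀ g ∈ flagStabilizer V.1 ⊓ flagStabilizer W.1,
          flagChar l γ (glEnd g) V.1 = flagChar l γ (glEnd g) W.1 then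
        Nat.card ↥(flagStabilizer V.1 ⊓ flagStabilizer W.1) else 0 : ℕ) : ℂ) := by
  simp only [HC_eq_sum, Finset.sum_mul_sum, flagChar_inv]
  rw [Finset.sum_comm]
  push_cast
  refine Finset.sum_congr rfl fun V _ => ?_
  rw [Finset.sum_comm]
  refine Finset.sum_congr rfl fun W _ => ?_
  rw [← sum_flagChar_mul_inv l γ V.2.2.1 W.2.2.1]
  refine Finset.sum_congr rfl fun g _ => ?_
  by_cases h1 : g ∈ flagStabilizer V.1 <;> by_cases h2 : g ∈ flagStabilizer W.1 <;>
    simp [h1, h2, Subgroup.mem_inf]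

theorem inner_HC_eq_one_iff {β : ℕ → ℕ} {l : ℕ} (hβ : ∀ j, l < j → β j = 0)
    (V₀ : Flag F n β) (γ : ℕ → (Fˣ →* ℂˣ)) :
    (Nat.card (GL (Fin n) F) : ℂ)⁻¹ *
        ∑ᶠ g : GL (Fin n) F, HC F n l β γ g * HC F n l β (fun j => (γ j)⁻¹) g = 1 ↔
      ∀ V W : Flag F n β, V ≠ W → ∃ g ∈ flagStabilizer V.1 ⊓ flagStabilizer W.1,
        flagChar l γ (glEnd g) V.1 ≠ flagChar l γ (glEnd g) W.1 := by
  have := finite_flag (F := F) (n := n) hβ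
  have := Fintype.ofFinite (Flag F n β)
  have hcard : (Nat.card (GL (Fin n) F) : ℂ) ≠ 0 := Nat.cast_ne_zero.mpr Nat.card_pos.ne'
  rw [finsum_eq_sum_of_fintype, sum_HC_mul_HC_inv, inv_mul_eq_one₀ hcard, Nat.cast_inj,
    ← sum_card_flagStabilizer hβ V₀]
  have hle : ∀ V ∈ (Finset.univ : Finset (Flag F n β)), Nat.card (flagStabilizer V.1) ≤
      ∑ W : Flag F n β, if ∀ g ∈ flagStabilizer V.1 ⊓ flagStabilizer W.1,
          flagChar l γ (glEnd g) V.1 = flagChar l γ (glEnd g) W.1 then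
        Nat.card ↥(flagStabilizer V.1 ⊓ flagStabilizer W.1) else 0 := by
    intro V _
    rw [← Finset.add_sum_erase _ _ (Finset.mem_univ V), if_pos (fun _ _ => rfl), inf_idem]
    exact Nat.le_add_right _ _
  rw [Finset.sum_eq_sum_iff_of_le hle]
  simp only [Finset.mem_univ, true_imp_iff]
  refine forall_congr' fun V => ?_
  rw [← Finset.add_sum_erase _ _ (Finset.mem_univ V), if_pos (fun _ _ => rfl), inf_idem,
    left_eq_add, Finset.sum_eq_zero_iff]
  refine forall_congr' fun W => ?_
  rw [Finset.mem_erase, ne_comm, and_iff_left (Finset.mem_univ W)]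
  refine imp_congr_right fun _ => ?_
  rw [ite_eq_right_iff]
  constructor
  · intro h
    by_contra! h'
    exact Nat.card_pos.ne' (h h')
  · rintro ⟨g, hg, hne⟩ h
    exact absurd (h g hg) hne

end Counting

end QRep

open QRep in
/-- `⟨R(γ_0,…,γ_l), R(γ_0,…,γ_l)⟩ =
(1/|GL_n(𝔽_q)|) Σ_g R(γ_0,…,γ_l)(g) · R(γ_0^{-1},…,γ_l^{-1})(g) = 1` if and only if the
characters `γ_0, …, γ_l` are pairwise distinct (i.e. the Harish-Chandra induced
character is irreducible iff the `γ_j` are pairwise distinct). -/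
theorem statement11 (F : Type) [Field F] [Fintype F] (l : ℕ) (nn : ℕ → ℕ)
    (hpos : ∀ j ≤ l, 1 ≤ nn j) (β : ℕ → ℕ)
    (hβ : β = fun j => ∑ h ∈ Finset.Icc j l, nn h) (γ : ℕ → (Fˣ →* ℂˣ)) :
    (Nat.card (GL (Fin (β 0)) F) : ℂ)⁻¹ *
        ∑ᶠ g : GL (Fin (β 0)) F,
          HC F (β 0) l β γ g * HC F (β 0) l β (fun j => (γ j)⁻¹) g = 1 ↔
      ∀ i ≤ l, ∀ j ≤ l, i ≠ j → γ i ≠ γ j := by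
  have hmono : ∀ j ≤ l, β (j + 1) < β j := fun j hj => by
    simp only [hβ]
    rw [← Finset.sum_Ioc_add_eq_sum_Icc hj, ← Finset.Icc_succ_left_eq_Ioc]
    exact Nat.lt_add_of_pos_right (hpos j hj)
  have hzero : ∀ j, l < j → β j = 0 := fun j hj => by
    simp only [hβ]
    rw [Finset.Icc_eq_empty (by omega), Finset.sum_empty]
  have hanti : Antitone β := antitone_nat_of_succ_le fun j => by
    by_cases hj : j ≤ l
    · exact (hmono j hj).le
    · rw [hzero (j + 1) (by omega)]
      exact Nat.zero_le _
  rw [inner_HC_eq_one_iff hzero ⟨_, isFlag_coordFlag hanti 1⟩]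
  constructor
  · intro h
    have hlt : ∀ i j, i < j → j ≤ l → γ i ≠ γ j := by
      intro i j hij hj heq
      obtain ⟨V, W, hV, hW, hne, hVW⟩ := exists_flag_pair_flagChar_eq (F := F) hanti hij hj
        (hmono i (by omega)) (hmono j hj) heq
      obtain ⟨g, hg, hgne⟩ := h ⟨V, hV⟩ ⟨W, hW⟩ fun h => hne (congrArg Subtype.val h)
      exact hgne (hVW _ (glEnd_injective g) hg.1 hg.2)
    intro i hi j hj hij
    rcases hij.lt_or_gt with h' | h'
    · exact hlt i j h' hj
    · exact (hlt j i h' hi).symm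
  · intro h V W hne
    obtain ⟨T, hTV, hTW, hT⟩ := V.2.exists_flagChar_ne hzero W.2
      (fun h => hne (Subtype.ext h)) h
    obtain ⟨g, hg⟩ := exists_glEnd_eq T
    rw [← hg] at hTV hTW hT
    exact ⟨g, ⟨hTV, hTW⟩, hT⟩
end

section
/- With the star-shaped quiver data fixed and all characters trivial (γ_{i,j} = 1 for all i, j), the multiplicity (1/|GL_n(𝔽_q)|) · Σ_{h ∈ GL_n(𝔽_q)} Λ_m(h) · ∏_{i=1}^k R(1,…,1)(h) equals the number of GL_α(𝔽_q)-orbits of representations x ∈ R(Q,α)(𝔽_q) all of whose matrices on the leg arrows [i,j] → [i,j−1] are injective. -/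
open Matrix

namespace QRep

variable {I Ω : Type} (src tgt : Ω → I)

/-- A representation of the quiver with arrow set `Ω`, tail map `src`, head map `tgt`,
of dimension vector `β`, over the field `K`: a matrix of size `β (tgt a) × β (src a)`
for every arrow `a`. -/
def Rep (K : Type) [Field K] (β : I → ℕ) : Type :=
  ∀ a : Ω, Matrix (Fin (β (tgt a))) (Fin (β (src a))) K

/-- Isomorphism of representations (of possibly different dimension vectors). -/
def RepIso {K : Type} [Field K] {β γ : I → ℕ} (x : Rep src tgt K β) (y : Rep src tgt K γ) :
    Prop :=
  ∃ e : ∀ i, (Fin (β i) → K) ≃ₗ[K] (Fin (γ i) → K),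
    ∀ a : Ω, (Matrix.mulVecLin (y a)).comp (e (src a) : (Fin (β (src a)) → K) →ₗ[K] _)
      = ((e (tgt a) : (Fin (β (tgt a)) → K) →ₗ[K] _)).comp (Matrix.mulVecLin (x a))

/-- Direct sum (block diagonal) of two representations. -/
def dsum {K : Type} [Field K] {β γ : I → ℕ} (x : Rep src tgt K β) (y : Rep src tgt K γ) :
    Rep src tgt K (β + γ) :=
  fun a => Matrix.reindex finSumFinEquiv finSumFinEquiv (Matrix.fromBlocks (x a) 0 0 (y a))

/-- A representation is indecomposable if its dimension vector is nonzero and it is not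
isomorphic to a direct sum of two representations of nonzero dimension vectors. -/
def Indec {K : Type} [Field K] {β : I → ℕ} (x : Rep src tgt K β) : Prop :=
  β ≠ 0 ∧ ∀ (β₁ β₂ : I → ℕ) (y : Rep src tgt K β₁) (z : Rep src tgt K β₂),
    β₁ ≠ 0 → β₂ ≠ 0 → ¬ RepIso src tgt x (dsum src tgt y z)

/-- Base change of a representation along a ring homomorphism of fields. -/
def baseChange {K L : Type} [Field K] [Field L] (f : K →+* L) {β : I → ℕ}
    (x : Rep src tgt K β) : Rep src tgt L β :=
  fun a => (x a).map f

/-- `x` is of level at most `V`: every indecomposable direct summand of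
`x ⊗ K̄` has dimension vector belonging to `V`. -/
def LevelAtMost {K : Type} [Field K] {β : I → ℕ} (x : Rep src tgt K β)
    (V : Set (I → ℕ)) : Prop :=
  ∀ (γ δ : I → ℕ) (Y : Rep src tgt (AlgebraicClosure K) γ)
    (z : Rep src tgt (AlgebraicClosure K) δ), Indec src tgt Y →
    RepIso src tgt (baseChange src tgt (algebraMap K (AlgebraicClosure K)) x)
      (dsum src tgt Y z) → γ ∈ V

/-- The action of `GL_β(K)` on representations of dimension vector `β`. -/
def glAct {K : Type} [Field K] {β : I → ℕ} (g : ∀ i, GL (Fin (β i)) K)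
    (x : Rep src tgt K β) : Rep src tgt K β :=
  fun a => ((g (tgt a) : Matrix (Fin (β (tgt a))) (Fin (β (tgt a))) K) * x a) *
    (((g (src a))⁻¹ : GL (Fin (β (src a))) K) : Matrix (Fin (β (src a))) (Fin (β (src a))) K)

/-- The number of `GL_β(K)`-orbits of representations of dimension vector `β`
satisfying the property `P`. -/
noncomputable def orbitCount {K : Type} [Field K] (β : I → ℕ)
    (P : Rep src tgt K β → Prop) : ℕ :=
  Nat.card (Quot fun x y : {x : Rep src tgt K β // P x} =>
    ∃ g : ∀ i, GL (Fin (β i)) K, glAct src tgt g x.1 = y.1)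


open scoped Classical

/-- Vertices of the star-shaped quiver: `none` is the central vertex `0`, and
`some ⟨i, j⟩` is the vertex `[i, j+1]` on leg `i` (so `j : Fin (s i)` runs through the
leg vertices `[i,1], …, [i, s_i]`). -/
abbrev StarV (k : ℕ) (s : Fin k → ℕ) := Option ((i : Fin k) × Fin (s i))

/-- Arrows of the star-shaped quiver: `m` loops at the central vertex together with, for
each leg `i` and each `j`, one arrow `[i, j+1] → [i, j]`. -/
abbrev StarA (k m : ℕ) (s : Fin k → ℕ) := Fin m ⊕ ((i : Fin k) × Fin (s i))

/-- The vertex `[i, j]` preceding `[i, j+1]` on a leg (the central vertex if `j = 0`). -/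
def legPrev (k : ℕ) (s : Fin k → ℕ) (a : (i : Fin k) × Fin (s i)) : StarV k s :=
  if h : a.2.1 = 0 then none
  else some ⟨a.1, ⟨a.2.1 - 1, lt_of_le_of_lt (Nat.pred_le _) a.2.2⟩⟩

/-- Tail map of the star-shaped quiver. -/
def starSrc (k m : ℕ) (s : Fin k → ℕ) : StarA k m s → StarV k s
  | .inl _ => none
  | .inr a => some a

/-- Head map of the star-shaped quiver. -/
def starTgt (k m : ℕ) (s : Fin k → ℕ) : StarA k m s → StarV k s
  | .inl _ => none
  | .inr a => legPrev k s a

/-- A dimension vector is non-increasing along each leg. -/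
def NonIncr (k : ℕ) (s : Fin k → ℕ) (δ : StarV k s → ℕ) : Prop :=
  ∀ a : (i : Fin k) × Fin (s i), δ (some a) ≤ δ (legPrev k s a)

/-- `legβ k s nn i j = n_{i,j} + n_{i,j+1} + ⋯ + n_{i,s_i}`. -/
def legβ (k : ℕ) (s : Fin k → ℕ) (nn : Fin k → ℕ → ℕ) (i : Fin k) (j : ℕ) : ℕ :=
  ∑ h ∈ Finset.Icc j (s i), nn i h

/-- The dimension vector `α`: `α_0 = n`, `α_{[i,j]} = n_{i,j} + ⋯ + n_{i,s_i}`. -/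
def starα (k n : ℕ) (s : Fin k → ℕ) (nn : Fin k → ℕ → ℕ) : StarV k s → ℕ
  | none => n
  | some a => legβ k s nn a.1 (a.2.1 + 1)

/-- The tuple `σ`: `σ_0 = ∏_i γ_{i,0}` and `σ_{[i,j]} = γ_{i,j} γ_{i,j-1}^{-1}`. -/
noncomputable def starσ (F : Type) [Field F] (k : ℕ) (s : Fin k → ℕ)
    (γ : Fin k → ℕ → (Fˣ →* ℂˣ)) : StarV k s → (Fˣ →* ℂˣ)
  | none => ∏ i, γ i 0
  | some a => γ a.1 (a.2.1 + 1) * (γ a.1 a.2.1)⁻¹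


/-- The multiplicity `⟨Λ ⊗ R(γ_1) ⊗ ⋯ ⊗ R(γ_k), 1⟩ =
(1/|GL_n(𝔽_q)|) Σ_h Λ_m(h) ∏_i R(γ_i)(h)`. -/
noncomputable def mult (F : Type) [Field F] [Fintype F] (k m n : ℕ) (s : Fin k → ℕ)
    (nn : Fin k → ℕ → ℕ) (γ : Fin k → ℕ → (Fˣ →* ℂˣ)) : ℂ :=
  (Nat.card (GL (Fin n) F) : ℂ)⁻¹ *
    ∑ᶠ h : GL (Fin n) F,
      (Λcount F n m h : ℂ) * ∏ i : Fin k, HC F n (s i) (legβ k s nn i) (γ i) h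

end QRep

namespace QRep

section LinearAlgebra

variable {F : Type} [Field F]

lemma mul_left_cancel_of_injective {a b c : ℕ} {C : Matrix (Fin a) (Fin b) F}
    (hC : Function.Injective C.mulVecLin) {A B : Matrix (Fin b) (Fin c) F}
    (h : C * A = C * B) : A = B := by
  apply Matrix.ext_of_mulVec_single
  intro i
  apply hC
  simp only [Matrix.mulVecLin_apply, Matrix.mulVec_mulVec, h]

lemma GL_mulVecLin_injective {a : ℕ} (g : GL (Fin a) F) :
    Function.Injective (g : Matrix (Fin a) (Fin a) F).mulVecLin := by
  intro v w h
  have h' := congrArg (fun u => ((g⁻¹ : GL (Fin a) F) : Matrix (Fin a) (Fin a) F).mulVec u) h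
  simpa [Matrix.mulVec_mulVec, ← Units.val_mul] using h'

/-- Two injective matrices with the same column space differ by an invertible matrix. -/
lemma exists_GL_of_range_eq {n a : ℕ} {C D : Matrix (Fin n) (Fin a) F}
    (hC : Function.Injective C.mulVecLin) (hD : Function.Injective D.mulVecLin)
    (hCD : LinearMap.range C.mulVecLin = LinearMap.range D.mulVecLin) :
    ∃ g : GL (Fin a) F, D * (g : Matrix (Fin a) (Fin a) F) = C := by
  have key : ∀ C D : Matrix (Fin n) (Fin a) F, Function.Injective D.mulVecLin →
      LinearMap.range C.mulVecLin = LinearMap.range D.mulVecLin →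
      ∃ A : Matrix (Fin a) (Fin a) F, D * A = C := by
    intro C D hD h
    obtain ⟨l, hl⟩ := LinearMap.exists_leftInverse_of_injective D.mulVecLin
      (LinearMap.ker_eq_bot.2 hD)
    refine ⟨LinearMap.toMatrix' (l.comp C.mulVecLin), ?_⟩
    apply Matrix.ext_of_mulVec_single
    intro i
    have hm : C.mulVecLin (Pi.single i 1) ∈ LinearMap.range D.mulVecLin := h ▸ ⟨_, rfl⟩
    obtain ⟨w, hw⟩ := hm
    have hlw : l (D.mulVecLin w) = w := LinearMap.congr_fun hl w
    rw [← Matrix.mulVec_mulVec, LinearMap.toMatrix'_mulVec, LinearMap.comp_apply, ← hw, hlw]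
    simpa using hw
  obtain ⟨A, hA⟩ := key C D hD hCD
  obtain ⟨B, hB⟩ := key D C hC hCD.symm
  exact ⟨⟨A, B, mul_left_cancel_of_injective hD (by rw [← Matrix.mul_assoc, hA, hB, Matrix.mul_one]),
    mul_left_cancel_of_injective hC (by rw [← Matrix.mul_assoc, hB, hA, Matrix.mul_one])⟩, hA⟩

/-- Every subspace of `F ^ n` is the column space of an injective matrix. -/
lemma exists_injective_range_eq {n a : ℕ} (W : Submodule F (Fin n → F))
    (hW : Module.finrank F W = a) :
    ∃ C : Matrix (Fin n) (Fin a) F, Function.Injective C.mulVecLin ∧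
      LinearMap.range C.mulVecLin = W := by
  let e : (Fin a → F) ≃ₗ[F] W := LinearEquiv.ofFinrankEq _ _ (by simp [hW])
  refine ⟨LinearMap.toMatrix' (W.subtype.comp (e : (Fin a → F) →ₗ[F] W)), ?_, ?_⟩
  · rw [← Matrix.toLin'_apply', Matrix.toLin'_toMatrix']
    exact Subtype.val_injective.comp e.injective
  · rw [← Matrix.toLin'_apply', Matrix.toLin'_toMatrix', LinearMap.range_comp,
      LinearEquiv.range, Submodule.map_top, Submodule.range_subtype]

/-- If the column space of `C` lies in that of `D`, then `C` factors through `D`. -/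
lemma exists_mul_eq_of_range_le {n a b : ℕ} {C : Matrix (Fin n) (Fin a) F}
    {D : Matrix (Fin n) (Fin b) F}
    (h : LinearMap.range C.mulVecLin ≤ LinearMap.range D.mulVecLin) :
    ∃ A : Matrix (Fin b) (Fin a) F, D * A = C := by
  have hm : ∀ i : Fin a, ∃ w, D.mulVecLin w = C.mulVecLin (Pi.single i 1) :=
    fun i => h ⟨_, rfl⟩
  choose w hw using hm
  refine ⟨Matrix.of fun i j => w j i, ?_⟩
  apply Matrix.ext_of_mulVec_single
  intro i
  rw [← Matrix.mulVec_mulVec]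
  refine Eq.trans ?_ (hw i)
  congr 1
  ext j
  simp

lemma finrank_map_mulVecLin {n : ℕ} (g : GL (Fin n) F) (W : Submodule F (Fin n → F)) :
    Module.finrank F (W.map g.1.mulVecLin) = Module.finrank F W :=
  (Submodule.equivMapOfInjective _ (GL_mulVecLin_injective g) W).finrank_eq.symm

lemma map_mulVecLin_eq_iff {n : ℕ} (g : GL (Fin n) F) (W : Submodule F (Fin n → F)) :
    W.map g.1.mulVecLin = W ↔ ∀ v ∈ W, g.1.mulVecLin v ∈ W :=
  ⟨fun h _ hv => h.le (Submodule.mem_map_of_mem hv), fun h =>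
    Submodule.eq_of_le_of_finrank_eq (Submodule.map_le_iff_le_comap.2 h)
      (finrank_map_mulVecLin g W)⟩

lemma quotDet_ne_zero {n : ℕ} (g : GL (Fin n) F) {W U : Submodule F (Fin n → F)}
    (hW : ∀ v ∈ W, (g : Matrix (Fin n) (Fin n) F).mulVecLin v ∈ W)
    (hU : ∀ v ∈ U, (g : Matrix (Fin n) (Fin n) F).mulVecLin v ∈ U) :
    quotDet (g : Matrix (Fin n) (Fin n) F).mulVecLin W U ≠ 0 := by
  have hinj := GL_mulVecLin_injective g
  have hmap := (map_mulVecLin_eq_iff g U).2 hU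
  rw [quotDet, dif_pos ⟨hW, hU⟩]
  refine (LinearMap.isUnit_iff_isUnit_det _).1 ?_ |>.ne_zero
  rw [LinearMap.isUnit_iff_ker_eq_bot, LinearMap.ker_eq_bot']
  intro q hq
  obtain ⟨w, rfl⟩ := Submodule.Quotient.mk_surjective _ q
  rw [Submodule.mapQ_apply, Submodule.Quotient.mk_eq_zero] at hq
  rw [Submodule.Quotient.mk_eq_zero]
  have hq' : (g : Matrix (Fin n) (Fin n) F).mulVecLin w.1 ∈ U := hq
  rw [← hmap] at hq'
  obtain ⟨u, hu, huw⟩ := hq'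
  exact (hinj huw ▸ hu : w.1 ∈ U)

end LinearAlgebra

/-- The flags of `F ^ n` of type `β` stable under `g`. -/
abbrev StableFlag (F : Type) [Field F] (n : ℕ) (β : ℕ → ℕ) (g : GL (Fin n) F) : Type :=
  {V : ℕ → Submodule F (Fin n → F) //
      V 0 = ⊤ ∧ (∀ j, V (j + 1) ≤ V j) ∧ (∀ j, Module.finrank F (V j) = β j) ∧
      (∀ j, ∀ v ∈ V j, Matrix.mulVecLin (g : Matrix (Fin n) (Fin n) F) v ∈ V j)}

lemma HC_one (F : Type) [Field F] (n l : ℕ) (β : ℕ → ℕ) (g : GL (Fin n) F) :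
    HC F n l β (fun _ => 1) g = Nat.card (StableFlag F n β g) := by
  have h : ∀ V : StableFlag F n β g, ∏ j ∈ Finset.range (l + 1),
      χap (1 : Fˣ →* ℂˣ) (quotDet (Matrix.mulVecLin (g : Matrix (Fin n) (Fin n) F))
        (V.1 j) (V.1 (j + 1))) = 1 := by
    intro V
    refine Finset.prod_eq_one fun j _ => ?_
    rw [χap, dif_neg (quotDet_ne_zero g (V.2.2.2.2 j) (V.2.2.2.2 (j + 1)))]
    simp
  rw [HC, finsum_congr h]
  rcases finite_or_infinite (StableFlag F n β g) with hfin | hinf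
  · have := Fintype.ofFinite (StableFlag F n β g)
    rw [finsum_eq_sum_of_fintype]
    simp
  · rw [finsum_of_infinite_support (by simpa [Function.support_const] using Set.infinite_univ),
      Nat.card_eq_zero_of_infinite, Nat.cast_zero]

section Star

variable (F : Type) [Field F] (k m n : ℕ) (s : Fin k → ℕ) (α : StarV k s → ℕ)

/-- Tuples of `m` endomorphisms of `F ^ n` together with `k` partial flags whose types are
given by the dimension vector `α` of the star-shaped quiver. -/
@[ext]
structure FlagConfig where
  /-- The endomorphisms. -/
  endo : Fin m → Matrix (Fin n) (Fin n) F
  /-- The steps of the flags, indexed by the vertices of the quiver. -/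
  step : StarV k s → Submodule F (Fin n → F)
  step_none : step none = ⊤
  step_le : ∀ a, step (some a) ≤ step (legPrev k s a)
  finrank_step : ∀ a, Module.finrank F (step (some a)) = α (some a)

instance [Finite F] : Finite (FlagConfig F k m n s α) := by
  have : Finite (Submodule F (Fin n → F)) :=
    Finite.of_injective (fun W => (W : Set (Fin n → F))) SetLike.coe_injective
  refine Finite.of_injective (fun p : FlagConfig F k m n s α => (p.endo, p.step)) ?_
  intro p p' h
  exact FlagConfig.ext (Prod.ext_iff.1 h).1 (Prod.ext_iff.1 h).2

instance : MulAction (GL (Fin n) F) (FlagConfig F k m n s α) where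
  smul g p :=
    { endo := fun r => g.1 * p.endo r * (g⁻¹).1
      step := fun v => (p.step v).map g.1.mulVecLin
      step_none := by
        rw [p.step_none, Submodule.map_top, LinearMap.range_eq_top]
        exact LinearMap.surjective_of_injective (GL_mulVecLin_injective g)
      step_le := fun a => Submodule.map_mono (p.step_le a)
      finrank_step := fun a => (finrank_map_mulVecLin g _).trans (p.finrank_step a) }
  one_smul p := by
    refine FlagConfig.ext (funext fun r => ?_) (funext fun v => ?_)
    · change (1 : GL (Fin n) F).1 * p.endo r * ((1 : GL (Fin n) F)⁻¹).1 = p.endo r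
      simp
    · change (p.step v).map (1 : GL (Fin n) F).1.mulVecLin = p.step v
      simp
  mul_smul g h p := by
    refine FlagConfig.ext (funext fun r => ?_) (funext fun v => ?_)
    · change (g * h).1 * p.endo r * ((g * h)⁻¹).1 =
        g.1 * (h.1 * p.endo r * (h⁻¹).1) * (g⁻¹).1
      rw [_root_.mul_inv_rev, Units.val_mul, Units.val_mul]
      simp only [Matrix.mul_assoc]
    · change (p.step v).map (g * h).1.mulVecLin =
        ((p.step v).map h.1.mulVecLin).map g.1.mulVecLin
      rw [Units.val_mul, Matrix.mulVecLin_mul, Submodule.map_comp]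

variable {F k m n s α}

lemma FlagConfig.smul_eq_iff (g : GL (Fin n) F) (p p' : FlagConfig F k m n s α) :
    g • p = p' ↔ (∀ r, g.1 * p.endo r = p'.endo r * g.1) ∧
      ∀ v, (p.step v).map g.1.mulVecLin = p'.step v := by
  rw [FlagConfig.ext_iff, funext_iff, funext_iff]
  exact and_congr (forall_congr' fun r => Units.mul_inv_eq_iff_eq_mul g) Iff.rfl

/-- The flag on leg `i`, extended by zero beyond the end of the leg. -/
def FlagConfig.leg (p : FlagConfig F k m n s α) (i : Fin k) : ℕ → Submodule F (Fin n → F)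
  | 0 => ⊤
  | j + 1 => if h : j < s i then p.step (some ⟨i, ⟨j, h⟩⟩) else ⊥

lemma FlagConfig.leg_succ_of_lt (p : FlagConfig F k m n s α) {i : Fin k} {j : ℕ}
    (h : j < s i) : p.leg i (j + 1) = p.step (some ⟨i, ⟨j, h⟩⟩) :=
  dif_pos h

lemma FlagConfig.leg_succ_of_not_lt (p : FlagConfig F k m n s α) {i : Fin k} {j : ℕ}
    (h : ¬ j < s i) : p.leg i (j + 1) = ⊥ :=
  dif_neg h

lemma legβ_eq_zero (nn : Fin k → ℕ → ℕ) {i : Fin k} {j : ℕ} (h : s i < j) :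
    legβ k s nn i j = 0 := by
  rw [legβ, Finset.Icc_eq_empty (by omega), Finset.sum_empty]

variable (F k m s) in
/-- The configurations fixed by `g`, leg by leg. -/
noncomputable def fixedByEquiv (nn : Fin k → ℕ → ℕ) (hsum : ∀ i, legβ k s nn i 0 = n)
    (g : GL (Fin n) F) :
    MulAction.fixedBy (FlagConfig F k m n s (starα k n s nn)) g ≃
      {A : Fin m → Matrix (Fin n) (Fin n) F // ∀ r, g.1 * A r = A r * g.1} ×
        ∀ i, StableFlag F n (legβ k s nn i) g where
  toFun p := (⟨p.1.endo, ((FlagConfig.smul_eq_iff g _ _).1 p.2).1⟩, fun i => ⟨p.1.leg i, by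
    have hfix := ((FlagConfig.smul_eq_iff g _ _).1 p.2).2
    refine ⟨rfl, fun j => ?_, fun j => ?_, fun j => ?_⟩
    · rcases j with _ | j
      · exact le_top
      · simp only [FlagConfig.leg]
        split_ifs with h1 h2
        · exact p.1.step_le ⟨i, ⟨j + 1, h1⟩⟩
        · omega
        · exact bot_le
        · exact le_rfl
    · rcases j with _ | j
      · rw [FlagConfig.leg, finrank_top, Module.finrank_fin_fun, hsum]
      · by_cases h : j < s i
        · rw [p.1.leg_succ_of_lt h]
          exact p.1.finrank_step _
        · rw [p.1.leg_succ_of_not_lt h, finrank_bot, legβ_eq_zero nn (by omega)]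
    · rw [← map_mulVecLin_eq_iff]
      rcases j with _ | j
      · exact (map_mulVecLin_eq_iff g ⊤).2 fun _ _ => trivial
      · simp only [FlagConfig.leg]
        split_ifs with h1
        · exact hfix _
        · exact Submodule.map_bot _⟩)
  invFun q :=
    ⟨{ endo := q.1.1
       step := fun v => match v with
        | none => ⊤
        | some a => (q.2 a.1).1 (a.2.1 + 1)
       step_none := rfl
       step_le := by
        rintro ⟨i, j, hj⟩
        rcases j with _ | j
        · exact le_top
        · exact (q.2 i).2.2.1 (j + 1)
       finrank_step := fun a => (q.2 a.1).2.2.2.1 _ }, by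
      refine (FlagConfig.smul_eq_iff g _ _).2 ⟨q.1.2, fun v => ?_⟩
      rcases v with _ | a
      · exact (map_mulVecLin_eq_iff g ⊤).2 fun _ _ => trivial
      · exact (map_mulVecLin_eq_iff g _).2 ((q.2 a.1).2.2.2.2 _)⟩
  left_inv p := by
    refine Subtype.ext (FlagConfig.ext rfl (funext fun v => ?_))
    rcases v with _ | ⟨i, j, hj⟩
    · exact p.1.step_none.symm
    · simp [FlagConfig.leg, hj]
  right_inv q := by
    refine Prod.ext rfl (funext fun i => Subtype.ext (funext fun j => ?_))
    rcases j with _ | j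
    · exact (q.2 i).2.1.symm
    · by_cases h : j < s i
      · simp [FlagConfig.leg, h]
      · have h0 : Module.finrank F ((q.2 i).1 (j + 1)) = 0 := by
          rw [(q.2 i).2.2.2.1, legβ_eq_zero nn (by omega)]
        simpa [FlagConfig.leg, h] using (Submodule.finrank_eq_zero.1 h0).symm

/-- Distance of a vertex to the central vertex. -/
def depth : StarV k s → ℕ
  | none => 0
  | some a => a.2.1 + 1

lemma depth_legPrev_lt (a : (i : Fin k) × Fin (s i)) :
    depth (legPrev k s a) < depth (some a) := by
  obtain ⟨i, j, hj⟩ := a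
  rcases j with _ | j
  · simp [legPrev, depth]
  · simp [legPrev, depth]

lemma starV_induction {P : StarV k s → Prop} (h0 : P none)
    (hs : ∀ a, P (legPrev k s a) → P (some a)) (v : StarV k s) : P v :=
  match v with
  | none => h0
  | some a => hs a (starV_induction h0 hs (legPrev k s a))
termination_by depth v
decreasing_by exact depth_legPrev_lt a

variable {nn : Fin k → ℕ → ℕ}

/-- The matrix of the `r`-th loop. -/
abbrev loopMat (x : Rep (starSrc k m s) (starTgt k m s) F (starα k n s nn)) (r : Fin m) :
    Matrix (Fin n) (Fin n) F :=
  x (Sum.inl r)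

/-- The matrix of a leg arrow. -/
abbrev legMat (x : Rep (starSrc k m s) (starTgt k m s) F (starα k n s nn))
    (a : (i : Fin k) × Fin (s i)) :
    Matrix (Fin (starα k n s nn (legPrev k s a))) (Fin (starα k n s nn (some a))) F :=
  x (Sum.inr a)

/-- The composite of the arrows from a vertex to the central vertex. -/
def toCenter (x : Rep (starSrc k m s) (starTgt k m s) F (starα k n s nn)) :
    ∀ v : StarV k s, Matrix (Fin n) (Fin (starα k n s nn v)) F
  | none => (1 : Matrix (Fin n) (Fin n) F)
  | some a => toCenter x (legPrev k s a) * legMat x a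
termination_by v => depth v
decreasing_by exact depth_legPrev_lt a

variable {x y : Rep (starSrc k m s) (starTgt k m s) F (starα k n s nn)}

/-- All matrices on the leg arrows are injective. -/
def LegInjective (x : Rep (starSrc k m s) (starTgt k m s) F (starα k n s nn)) : Prop :=
  ∀ a : (i : Fin k) × Fin (s i), Function.Injective (Matrix.mulVecLin (x (Sum.inr a)))

lemma toCenter_none : toCenter x none = (1 : Matrix (Fin n) (Fin n) F) := by
  rw [toCenter]

lemma mulVecLin_toCenter_none : (toCenter x none).mulVecLin =
    (LinearMap.id : (Fin n → F) →ₗ[F] (Fin n → F)) :=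
  (congrArg Matrix.mulVecLin (toCenter_none (x := x))).trans Matrix.mulVecLin_one

lemma toCenter_some (a : (i : Fin k) × Fin (s i)) :
    toCenter x (some a) = toCenter x (legPrev k s a) * legMat x a := by
  rw [toCenter]

lemma toCenter_injective (hx : LegInjective x) (v : StarV k s) :
    Function.Injective (toCenter x v).mulVecLin := by
  induction v using starV_induction with
  | h0 => rw [mulVecLin_toCenter_none]; exact Function.injective_id
  | hs a ih =>
    rw [toCenter_some, Matrix.mulVecLin_mul, LinearMap.coe_comp]
    exact ih.comp (hx a)

/-- The configuration of endomorphisms and flags attached to a representation with injective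
leg maps. -/
def toConfig (x : {x : Rep (starSrc k m s) (starTgt k m s) F (starα k n s nn) //
    LegInjective x}) : FlagConfig F k m n s (starα k n s nn) where
  endo := loopMat x.1
  step v := LinearMap.range (toCenter x.1 v).mulVecLin
  step_none := (congrArg LinearMap.range mulVecLin_toCenter_none).trans LinearMap.range_id
  step_le a := by
    rw [toCenter_some, Matrix.mulVecLin_mul]
    exact LinearMap.range_comp_le_range _ _
  finrank_step a := (LinearMap.finrank_range_of_inj (toCenter_injective x.2 _)).trans (by simp)

lemma toConfig_surjective : Function.Surjective (toConfig (F := F) (k := k) (m := m) (n := n)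
    (s := s) (nn := nn)) := by
  rintro ⟨A, W, hW0, hWle, hWrank⟩
  choose E hEinj hErange using fun a => exists_injective_range_eq (W (some a)) (hWrank a)
  let e : ∀ v, Matrix (Fin n) (Fin (starα k n s nn v)) F := fun v => match v with
    | none => (1 : Matrix (Fin n) (Fin n) F)
    | some a => E a
  have hrange : ∀ v, LinearMap.range (e v).mulVecLin = W v := by
    rintro (_ | a)
    · exact ((congrArg LinearMap.range Matrix.mulVecLin_one).trans LinearMap.range_id).trans
        hW0.symm
    · exact hErange a
  choose X hX using fun a => exists_mul_eq_of_range_le (C := e (some a))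
    (D := e (legPrev k s a)) (by rw [hrange, hrange]; exact hWle a)
  let x : Rep (starSrc k m s) (starTgt k m s) F (starα k n s nn) := fun b => match b with
    | .inl r => A r
    | .inr a => X a
  have hx : LegInjective x := by
    intro a
    have h := hEinj a
    change Function.Injective (e (some a)).mulVecLin at h
    rw [← hX a, Matrix.mulVecLin_mul, LinearMap.coe_comp] at h
    exact h.of_comp
  have hc : ∀ v, toCenter x v = e v := by
    intro v
    induction v using starV_induction with
    | h0 => exact toCenter_none
    | hs a ih => rw [toCenter_some, ih]; exact hX a
  refine ⟨⟨x, hx⟩, FlagConfig.ext rfl (funext fun v => ?_)⟩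
  change LinearMap.range (toCenter x v).mulVecLin = W v
  rw [hc, hrange]

lemma glAct_eq_iff (g : ∀ v, GL (Fin (starα k n s nn v)) F) :
    glAct (starSrc k m s) (starTgt k m s) g x = y ↔
      ∀ b, (g (starTgt k m s b)).1 * x b = y b * (g (starSrc k m s b)).1 := by
  refine funext_iff.trans (forall_congr' fun b => ?_)
  constructor
  · intro h
    rw [← h, glAct, Matrix.mul_assoc, ← Units.val_mul, inv_mul_cancel, Units.val_one,
      Matrix.mul_one]
  · intro h
    rw [glAct, h, Matrix.mul_assoc, ← Units.val_mul, mul_inv_cancel, Units.val_one,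
      Matrix.mul_one]

/-- The component of an element of `GL_α` at the central vertex. -/
abbrev centerGL (g : ∀ v, GL (Fin (starα k n s nn v)) F) : GL (Fin n) F :=
  g none

lemma glAct_eq_iff_loop_leg (g : ∀ v, GL (Fin (starα k n s nn v)) F) :
    glAct (starSrc k m s) (starTgt k m s) g x = y ↔
      (∀ r, (centerGL g).1 * loopMat x r = loopMat y r * (centerGL g).1) ∧
      ∀ a, (g (legPrev k s a)).1 * legMat x a = legMat y a * (g (some a)).1 :=
  (glAct_eq_iff g).trans Sum.forall

lemma toCenter_none_mul_eq_iff (g : GL (Fin n) F)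
    (h : ∀ v, GL (Fin (starα k n s nn v)) F) :
    toCenter y none * (h none).1 = g.1 * toCenter x none ↔ centerGL h = g := by
  rw [toCenter_none, toCenter_none]
  refine Iff.trans ?_ Units.ext_iff.symm
  exact Eq.congr (Matrix.one_mul (centerGL h).1) (Matrix.mul_one g.1)

lemma exists_glAct_iff (x y : {x : Rep (starSrc k m s) (starTgt k m s) F (starα k n s nn) //
    LegInjective x}) :
    (∃ g : ∀ v, GL (Fin (starα k n s nn v)) F,
      glAct (starSrc k m s) (starTgt k m s) g x.1 = y.1) ↔
      ∃ g : GL (Fin n) F, g • toConfig x = toConfig y := by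
  simp only [glAct_eq_iff_loop_leg, FlagConfig.smul_eq_iff]
  constructor
  · rintro ⟨g, hloop, hleg⟩
    refine ⟨centerGL g, hloop, fun v => ?_⟩
    have hc : ∀ v, toCenter y.1 v * (g v).1 = (centerGL g).1 * toCenter x.1 v := by
      intro v
      induction v using starV_induction with
      | h0 => exact (toCenter_none_mul_eq_iff (centerGL g) g).2 rfl
      | hs a ih =>
        rw [toCenter_some, toCenter_some, Matrix.mul_assoc, ← hleg, ← Matrix.mul_assoc, ih,
          Matrix.mul_assoc]
    change (LinearMap.range (toCenter x.1 v).mulVecLin).map (centerGL g).1.mulVecLin =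
      LinearMap.range (toCenter y.1 v).mulVecLin
    rw [← LinearMap.range_comp, ← Matrix.mulVecLin_mul, ← hc, Matrix.mulVecLin_mul]
    refine LinearMap.range_comp_of_range_eq_top _ (LinearMap.range_eq_top.2 ?_)
    exact LinearMap.surjective_of_injective (GL_mulVecLin_injective (g v))
  · rintro ⟨g, hloop, hstep⟩
    have hex : ∀ v, ∃ h : GL (Fin (starα k n s nn v)) F,
        toCenter y.1 v * h.1 = g.1 * toCenter x.1 v := by
      intro v
      refine exists_GL_of_range_eq ?_ (toCenter_injective y.2 v) ?_
      · rw [Matrix.mulVecLin_mul, LinearMap.coe_comp]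
        exact (GL_mulVecLin_injective g).comp (toCenter_injective x.2 v)
      · rw [Matrix.mulVecLin_mul, LinearMap.range_comp]
        exact hstep v
    choose h hh using hex
    have h0 : centerGL h = g := (toCenter_none_mul_eq_iff g h).1 (hh none)
    refine ⟨h, fun r => h0 ▸ hloop r, fun a => ?_⟩
    refine mul_left_cancel_of_injective (toCenter_injective y.2 (legPrev k s a)) ?_
    rw [← Matrix.mul_assoc, hh, Matrix.mul_assoc, ← toCenter_some, ← hh, toCenter_some,
      Matrix.mul_assoc]

lemma orbitCount_eq : orbitCount (starSrc k m s) (starTgt k m s) (K := F) (starα k n s nn)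
      LegInjective =
    Nat.card (MulAction.orbitRel.Quotient (GL (Fin n) F)
      (FlagConfig F k m n s (starα k n s nn))) := by
  have hrel : ∀ x y : {x : Rep (starSrc k m s) (starTgt k m s) F (starα k n s nn) //
      LegInjective x}, (MulAction.orbitRel (GL (Fin n) F)
        (FlagConfig F k m n s (starα k n s nn))) (toConfig y) (toConfig x) ↔
      ∃ g : ∀ v, GL (Fin (starα k n s nn v)) F,
        glAct (starSrc k m s) (starTgt k m s) g x.1 = y.1 :=
    fun x y => (exists_glAct_iff x y).symm
  refine Nat.card_eq_of_bijective (Quot.lift (fun x => Quotient.mk _ (toConfig x))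
    fun x y h => (Quotient.sound ((hrel x y).2 h)).symm) ⟨?_, ?_⟩
  · rintro ⟨x⟩ ⟨y⟩ h
    exact Quot.sound ((hrel x y).1 (Quotient.exact h.symm))
  · rintro ⟨p⟩
    obtain ⟨x, rfl⟩ := toConfig_surjective p
    exact ⟨Quot.mk _ x, rfl⟩

end Star

lemma sum_card_fixedBy (F : Type) [Field F] [Fintype F] {n : ℕ} (X : Type)
    [MulAction (GL (Fin n) F) X] [Finite X] :
    ∑ᶠ g : GL (Fin n) F, (Nat.card (MulAction.fixedBy X g) : ℂ) =
      Nat.card (GL (Fin n) F) * Nat.card (MulAction.orbitRel.Quotient (GL (Fin n) F) X) := by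
  classical
  have := Fintype.ofFinite X
  have := Fintype.ofFinite (GL (Fin n) F)
  have := Fintype.ofFinite (MulAction.orbitRel.Quotient (GL (Fin n) F) X)
  have h := MulAction.sum_card_fixedBy_eq_card_orbits_mul_card_group (GL (Fin n) F) X
  rw [finsum_eq_sum_of_fintype]
  simp only [Nat.card_eq_fintype_card]
  rw [mul_comm]
  exact_mod_cast h

end QRep

open QRep in
/-- With all characters trivial, the multiplicity
`(1/|GL_n(𝔽_q)|) Σ_h Λ_m(h) ∏_i R(1,…,1)(h)` equals the number of `GL_α(𝔽_q)`-orbits of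
representations of the star-shaped quiver of dimension `α` over `𝔽_q` all of whose leg
maps are injective. -/
theorem statement12 (F : Type) [Field F] [Fintype F] (k m n : ℕ) (hk : 1 ≤ k) (hn : 1 ≤ n)
    (s : Fin k → ℕ) (nn : Fin k → ℕ → ℕ) (hsum : ∀ i, legβ k s nn i 0 = n) :
    mult F k m n s nn (fun _ _ => 1) =
      (orbitCount (starSrc k m s) (starTgt k m s) (K := F) (starα k n s nn)
        (fun x => ∀ a : (i : Fin k) × Fin (s i),
          Function.Injective (Matrix.mulVecLin (x (Sum.inr a)))) : ℂ) := by
  have hterm : ∀ h : GL (Fin n) F,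
      (Λcount F n m h : ℂ) * ∏ i : Fin k, HC F n (s i) (legβ k s nn i) (fun _ => 1) h =
        Nat.card (MulAction.fixedBy (FlagConfig F k m n s (starα k n s nn)) h) := by
    intro h
    rw [Nat.card_congr (fixedByEquiv F k m s nn hsum h), Nat.card_prod, Nat.card_pi]
    simp only [HC_one]
    push_cast
    rfl
  have hcard : (Nat.card (GL (Fin n) F) : ℂ) ≠ 0 := Nat.cast_ne_zero.2 Nat.card_pos.ne'
  rw [mult, finsum_congr hterm, sum_card_fixedBy, inv_mul_cancel_left₀ hcard, ← orbitCount_eq]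
  rfl
end

section
/- Let q be a prime power, k ≥ 1, and δ_1,…,δ_k : 𝔽_q^× → ℂ^× group homomorphisms with δ_i^2 ≠ 1 for each i. For each i let R_i : GL_2(𝔽_q) → ℂ be the Harish-Chandra induced character R(δ_i, δ_i^{−1}) of the diagonal torus, i.e. R_i(g) = Σ over g-stable lines V ⊆ 𝔽_q^2 of δ_i(det(ḡ_{𝔽_q^2/V})) · δ_i^{−1}(det(g|_V)), where ḡ_{𝔽_q^2/V} is the map induced by g on 𝔽_q^2/V. Let N = #{A ⊆ {1,…,k} : ∏_{j∈A} δ_j = ∏_{h∉A} δ_h}. Then (1/|GL_2(𝔽_q)|) · Σ_{g ∈ GL_2(𝔽_q)} ∏_{i=1}^k R_i(g) = ((q+1)^{k−1} + (q−1) − 2^{k−1} q)/(q(q−1)) + N/2. -/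
open Matrix

namespace QRep

open scoped OnePoint

theorem conj_smul_smul_eq_iff {G X : Type} [Group G] [MulAction G X] (h g : G) (x : X) :
    (h * g * h⁻¹) • h • x = h • x ↔ g • x = x := by
  rw [← mul_smul, inv_mul_cancel_right, mul_smul, smul_left_cancel_iff]

instance {F : Type} [DecidableEq F] : DecidableEq (OnePoint F) :=
  inferInstanceAs (DecidableEq (Option F))

instance {F : Type} [Fintype F] : Fintype (OnePoint F) := inferInstanceAs (Fintype (Option F))

theorem card_onePoint {F : Type} [Fintype F] : Fintype.card (OnePoint F) = Fintype.card F + 1 :=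
  Fintype.card_option

theorem sum_onePoint {F : Type} [Fintype F] (f : OnePoint F → ℂ) : ∑ x, f x = f ∞ + ∑ t : F, f t :=
  Fintype.sum_option f

/-- Summation of a class function supported on elements with a fixed point, in terms of a
point stabilizer of a transitive action. -/
theorem sum_eq_card_mul_sum_stabilizer {G X : Type} [Group G] [Fintype G] [Fintype X]
    [DecidableEq X] [MulAction G X] [MulAction.IsPretransitive G X] (x₀ : X) (P : G → ℂ)
    (hconj : ∀ h g, P (h * g * h⁻¹) = P g) (h0 : ∀ g, (∀ x : X, g • x ≠ x) → P g = 0) :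
    ∑ g, P g = (Fintype.card X : ℂ) *
      ∑ g, if g • x₀ = x₀ then P g / (Finset.univ.filter fun x : X => g • x = x).card else 0 := by
  have hcard : ∀ h g : G, (Finset.univ.filter fun x : X => (h * g * h⁻¹) • x = x).card =
      (Finset.univ.filter fun x : X => g • x = x).card := fun h g => by
    refine (Finset.card_equiv (MulAction.toPerm h) fun x => ?_).symm
    simp [conj_smul_smul_eq_iff]
  have hg : ∀ g, P g = ∑ x : X, if g • x = x then
      P g / (Finset.univ.filter fun x : X => g • x = x).card else 0 := fun g => by
    rw [← Finset.sum_filter, Finset.sum_const, nsmul_eq_mul]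
    by_cases hn : (Finset.univ.filter fun x : X => g • x = x).card = 0
    · rw [hn, h0 g fun x hx => ?_]
      · simp
      · exact Finset.notMem_empty x (Finset.card_eq_zero.1 hn ▸ by simp [hx])
    · rw [mul_div_cancel₀ _ (Nat.cast_ne_zero.2 hn)]
  rw [Finset.sum_congr rfl fun g _ => hg g, Finset.sum_comm, Fintype.card, ← nsmul_eq_mul,
    ← Finset.sum_const]
  refine Finset.sum_congr rfl fun x _ => ?_
  obtain ⟨h, rfl⟩ := MulAction.exists_smul_eq G x₀ x
  refine (Fintype.sum_equiv (MulAut.conj h).toEquiv _ _ fun g => ?_).symm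
  simp only [MulEquiv.toEquiv_eq_coe, EquivLike.coe_coe, MulAut.conj_apply, conj_smul_smul_eq_iff,
    hconj]
  rw [← hcard h g]
  split_ifs <;> rfl

/-- Orthogonality of characters, applied to a product of sums `δ + δ⁻¹`. -/
theorem sum_units_prod_add_inv {F ι : Type} [Field F] [Fintype F] [DecidableEq F] [Fintype ι]
    [DecidableEq ι] (δ : ι → (Fˣ →* ℂˣ)) :
    ∑ c : Fˣ, ∏ i, ((δ i c : ℂ) + ((δ i c)⁻¹ : ℂˣ)) =
      ((Fintype.card F : ℂ) - 1) *
        Nat.card {A : Finset ι // ∏ j ∈ A, δ j = ∏ h ∈ Aᶜ, δ h} := by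
  classical
  have hcard : ((Fintype.card Fˣ : ℕ) : ℂ) = (Fintype.card F : ℂ) - 1 := by
    rw [Fintype.card_units, Nat.cast_sub Fintype.card_pos, Nat.cast_one]
  simp_rw [Finset.prod_add, Finset.powerset_univ]
  rw [Finset.sum_comm]
  have key : ∀ A : Finset ι, ∑ c : Fˣ, (∏ i ∈ A, (δ i c : ℂ)) *
      ∏ i ∈ Finset.univ \ A, (((δ i c)⁻¹ : ℂˣ) : ℂ) =
      if ∏ j ∈ A, δ j = ∏ h ∈ Aᶜ, δ h then (Fintype.card F : ℂ) - 1 else 0 := fun A => by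
    have hs := sum_hom_units ((Units.coeHom ℂ).comp ((∏ j ∈ A, δ j) / ∏ h ∈ Aᶜ, δ h))
    have hiff : (Units.coeHom ℂ).comp ((∏ j ∈ A, δ j) / ∏ h ∈ Aᶜ, δ h) = 1 ↔
        ∏ j ∈ A, δ j = ∏ h ∈ Aᶜ, δ h := by
      rw [← div_eq_one (a := ∏ j ∈ A, δ j)]
      constructor
      · intro h
        ext c
        exact DFunLike.congr_fun h c
      · intro h
        rw [h]
        ext c
        simp
    rw [← hcard, ← Nat.cast_zero, ← Nat.cast_ite, ← if_congr hiff rfl rfl, ← hs]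
    refine Finset.sum_congr rfl fun c _ => ?_
    rw [← Finset.compl_eq_univ_sdiff]
    simp [div_eq_mul_inv, MonoidHom.finsetProd_apply]
  rw [Finset.sum_congr rfl fun A _ => key A, ← Finset.sum_filter, Finset.sum_const, nsmul_eq_mul,
    mul_comm, Nat.card_eq_fintype_card, Fintype.card_subtype]

section Line

variable {F M : Type} [Field F] [AddCommGroup M] [Module F M]

theorem quotDet_bot_of_forall_eq_smul [FiniteDimensional F M] (T : M →ₗ[F] M) (W : Submodule F M)
    (c : F) (hW : Module.finrank F W = 1) (hT : ∀ x ∈ W, T x = c • x) : quotDet T W ⊥ = c := by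
  have h : (∀ x ∈ W, T x ∈ W) ∧ (∀ x ∈ (⊥ : Submodule F M), T x ∈ (⊥ : Submodule F M)) := by
    refine ⟨fun x hx => hT x hx ▸ W.smul_mem c hx, fun x hx => ?_⟩
    rw [Submodule.mem_bot] at hx ⊢
    simp [hx]
  rw [quotDet, dif_pos h]
  have hb : (⊥ : Submodule F M).comap W.subtype = ⊥ := by
    ext x; simp
  rw [show Submodule.mapQ ((⊥ : Submodule F M).comap W.subtype) _ (T.restrict h.1) _ =
      c • LinearMap.id from ?_, LinearMap.det_smul, LinearMap.det_id, mul_one]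
  · have := Submodule.finrank_quotient_add_finrank ((⊥ : Submodule F M).comap W.subtype)
    rw [hW, hb, finrank_bot, add_zero, ← hb] at this
    rw [this, pow_one]
  · refine LinearMap.ext fun x => ?_
    induction x using Submodule.Quotient.induction_on with
    | _ w =>
      rw [Submodule.mapQ_apply, LinearMap.smul_apply, LinearMap.id_apply,
        ← Submodule.Quotient.mk_smul]
      congr 1
      exact Subtype.ext (hT _ w.2)

theorem mul_quotDet_top_of_forall_eq_smul [FiniteDimensional F M] (T : M →ₗ[F] M)
    (U : Submodule F M) (c : F)
    (hU : Module.finrank F U = 1) (hT : ∀ x ∈ U, T x = c • x) :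
    c * quotDet T ⊤ U = LinearMap.det T := by
  have h : (∀ x ∈ (⊤ : Submodule F M), T x ∈ (⊤ : Submodule F M)) ∧ (∀ x ∈ U, T x ∈ U) :=
    ⟨fun _ _ => trivial, fun x hx => hT x hx ▸ U.smul_mem c hx⟩
  rw [quotDet, dif_pos h]
  have hU' : U.comap (⊤ : Submodule F M).subtype ≤
      (U.comap (⊤ : Submodule F M).subtype).comap (T.restrict h.1) := fun x hx => h.2 _ hx
  have hdet := LinearMap.det_eq_det_mul_det _ _ hU'
  have hrank : Module.finrank F (U.comap (⊤ : Submodule F M).subtype) = 1 := by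
    rw [← hU]
    exact (Submodule.comapSubtypeEquivOfLe (le_top : U ≤ ⊤)).finrank_eq
  have hres : (T.restrict h.1).restrict (p := U.comap (⊤ : Submodule F M).subtype) hU' =
      c • LinearMap.id :=
    LinearMap.ext fun x => by
      apply Subtype.ext
      apply Subtype.ext
      exact hT _ x.2
  rw [hres, LinearMap.det_smul, hrank, pow_one, LinearMap.det_id, mul_one] at hdet
  rw [← hdet]
  have := LinearMap.det_conj (T.restrict h.1) (Submodule.topEquiv (R := F) (M := M))
  rw [← this]
  rfl

end Line

variable {F : Type} [Field F]

/-- A nonzero vector on the line of `F²` parametrized by a point of the projective line. -/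
def pointVec (x : OnePoint F) : Fin 2 → F := x.elim ![1, 0] (fun t => ![t, 1])

theorem pointVec_ne_zero (x : OnePoint F) : pointVec x ≠ 0 := by
  cases x with
  | infty => exact fun h => one_ne_zero (congr_fun h 0)
  | coe t => exact fun h => one_ne_zero (congr_fun h 1)

/-- The eigenvalue of `g` on the line parametrized by a fixed point of `g`. -/
def eig (g : GL (Fin 2) F) (x : OnePoint F) : F := x.elim (g 0 0) (fun t => g 1 0 * t + g 1 1)

theorem eq_eig_of_smul_pointVec {g : GL (Fin 2) F} {x : OnePoint F} {c : F}
    (h : g • pointVec x = c • pointVec x) : eig g x = c := by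
  rw [Matrix.GeneralLinearGroup.fin_two_smul] at h
  cases x with
  | infty => simpa [pointVec, eig] using congr_fun h 0
  | coe t => simpa [pointVec, eig] using congr_fun h 1

/-- The line of `F²` parametrized by a point of the projective line. -/
def line (x : OnePoint F) : Submodule F (Fin 2 → F) := Submodule.span F {pointVec x}

theorem finrank_line (x : OnePoint F) : Module.finrank F (line x) = 1 :=
  finrank_span_singleton (pointVec_ne_zero x)

/-- The contribution of the line parametrized by `x` to the character induced from `δ ⊗ δ⁻¹`. -/
noncomputable def lineWeight (δ : Fˣ →* ℂˣ) (g : GL (Fin 2) F) (x : OnePoint F) : ℂ :=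
  χap δ ((g : Matrix (Fin 2) (Fin 2) F).det / eig g x) * χap δ⁻¹ (eig g x)

theorem χap_coe (δ : Fˣ →* ℂˣ) (u : Fˣ) : χap δ (u : F) = δ u := by
  rw [χap, dif_neg u.ne_zero, Units.mk0_val]

/-- The upper triangular matrix with rows `(a, b)` and `(0, d)`. -/
def upper (a d : Fˣ) (b : F) : GL (Fin 2) F :=
  Matrix.GeneralLinearGroup.mkOfDetNeZero !![(a : F), b; 0, (d : F)] (by simp)

theorem coe_upper (a d : Fˣ) (b : F) :
    (upper a d b : Matrix (Fin 2) (Fin 2) F) = !![(a : F), b; 0, (d : F)] := rfl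

theorem lineWeight_upper_infty (δ : Fˣ →* ℂˣ) (a d : Fˣ) (b : F) :
    lineWeight δ (upper a d b) ∞ = δ (d / a) := by
  have h : eig (upper a d b) ∞ = a := rfl
  rw [lineWeight, h, coe_upper, Matrix.det_fin_two_of, mul_zero, sub_zero,
    mul_div_cancel_left₀ _ a.ne_zero, χap_coe, χap_coe]
  simp [div_eq_mul_inv]

theorem lineWeight_upper_coe (δ : Fˣ →* ℂˣ) (a d : Fˣ) (b t : F) :
    lineWeight δ (upper a d b) t = ((δ (d / a))⁻¹ : ℂˣ) := by
  have h : eig (upper a d b) t = d := by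
    change 0 * t + (d : F) = d
    simp
  rw [lineWeight, h, coe_upper, Matrix.det_fin_two_of, mul_zero, sub_zero,
    mul_div_cancel_right₀ _ d.ne_zero, χap_coe, χap_coe]
  simp [div_eq_mul_inv]

theorem card_GL_two [Fintype F] : (Nat.card (GL (Fin 2) F) : ℂ) =
    ((Fintype.card F : ℂ) + 1) * ((Fintype.card F : ℂ) - 1) *
      (Fintype.card F * ((Fintype.card F : ℂ) - 1)) := by
  have h1 : 1 ≤ Fintype.card F := Fintype.card_pos
  rw [Matrix.card_GL_field, Fin.prod_univ_two, Nat.cast_mul, Nat.cast_sub, Nat.cast_sub]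
  · push_cast
    simp
    ring
  · exact Nat.pow_le_pow_right h1 (by simp)
  · exact Nat.pow_le_pow_right h1 (by simp)

section DecEq

variable [DecidableEq F]

theorem equivProjectivization_eq_mk (x : OnePoint F) :
    OnePoint.equivProjectivization F x = .mk F (pointVec x) (pointVec_ne_zero x) := by
  cases x <;> rfl

theorem exists_smul_pointVec (g : GL (Fin 2) F) (x : OnePoint F) :
    ∃ c : Fˣ, g • pointVec x = c • pointVec (g • x) := by
  have h := OnePoint.equivProjectivization_smul (g := g) x
  rw [equivProjectivization_eq_mk, equivProjectivization_eq_mk, Projectivization.smul_mk,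
    eq_comm, Projectivization.mk_eq_mk_iff] at h
  exact h.imp fun _ hc => hc.symm

theorem smul_eq_self_of_smul_pointVec {g : GL (Fin 2) F} {x : OnePoint F} {c : F}
    (h : g • pointVec x = c • pointVec x) : g • x = x := by
  apply (OnePoint.equivProjectivization F).injective
  rw [OnePoint.equivProjectivization_smul, equivProjectivization_eq_mk,
    Projectivization.smul_mk, Projectivization.mk_eq_mk_iff']
  exact ⟨c, h.symm⟩

theorem smul_pointVec {g : GL (Fin 2) F} {x : OnePoint F} (h : g • x = x) :
    g • pointVec x = eig g x • pointVec x := by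
  obtain ⟨c, hc⟩ := exists_smul_pointVec g x
  rw [h] at hc
  rw [eq_eig_of_smul_pointVec (c := (c : F)) hc]
  exact hc

theorem eig_ne_zero {g : GL (Fin 2) F} {x : OnePoint F} (h : g • x = x) : eig g x ≠ 0 := by
  obtain ⟨c, hc⟩ := exists_smul_pointVec g x
  rw [h] at hc
  rw [eq_eig_of_smul_pointVec (c := (c : F)) hc]
  exact c.ne_zero

theorem eig_conj {g : GL (Fin 2) F} (h : GL (Fin 2) F) {x : OnePoint F} (hx : g • x = x) :
    eig (h * g * h⁻¹) (h • x) = eig g x := by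
  obtain ⟨c, hc⟩ := exists_smul_pointVec h x
  rw [← inv_smul_eq_iff, Units.smul_def] at hc
  apply eq_eig_of_smul_pointVec
  rw [← hc, mul_smul, mul_smul, smul_comm h⁻¹, inv_smul_smul, smul_comm g, smul_pointVec hx,
    smul_comm h, smul_comm h, smul_comm (eig g x) ((c⁻¹ : Fˣ) : F)]

theorem forall_mem_line {g : GL (Fin 2) F} {x : OnePoint F} (h : g • x = x)
    (v : Fin 2 → F) (hv : v ∈ line x) :
    Matrix.mulVecLin (g : Matrix (Fin 2) (Fin 2) F) v = eig g x • v := by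
  obtain ⟨a, rfl⟩ := Submodule.mem_span_singleton.1 hv
  rw [map_smul, smul_comm, ← smul_pointVec h]
  rfl

theorem line_eq_submodule (x : OnePoint F) :
    line x = (OnePoint.equivProjectivization F x).submodule := by
  rw [equivProjectivization_eq_mk, Projectivization.submodule_mk, line]

theorem line_injective : Function.Injective (line (F := F)) := by
  intro x y h
  rw [line_eq_submodule, line_eq_submodule] at h
  exact (OnePoint.equivProjectivization F).injective (Projectivization.submodule_injective h)

theorem exists_line_eq (L : Submodule F (Fin 2 → F)) (hL : Module.finrank F L = 1) :
    ∃ x, line x = L :=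
  ⟨(OnePoint.equivProjectivization F).symm (Projectivization.mk'' L hL), by
    rw [line_eq_submodule, Equiv.apply_symm_apply, Projectivization.submodule_mk'']⟩

/-- The flag `F² ⊇ L ⊇ 0 ⊇ 0 ⊇ ⋯` attached to the line `L` parametrized by `x`. -/
def flag (x : OnePoint F) (j : ℕ) : Submodule F (Fin 2 → F) :=
  if j = 0 then ⊤ else if j = 1 then line x else ⊥

theorem HC_eq_sum_s13 [Fintype F] (δ : Fˣ →* ℂˣ) (g : GL (Fin 2) F) :
    HC F 2 1 (fun j => if j = 0 then 2 else if j = 1 then 1 else 0)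
      (fun j => if j = 0 then δ else δ⁻¹) g =
      ∑ x : OnePoint F, if g • x = x then lineWeight δ g x else 0 := by
  rw [← Finset.sum_filter, Finset.sum_subtype (p := fun x : OnePoint F => g • x = x) _ (by simp),
    ← finsum_eq_sum_of_fintype, HC, eq_comm]
  refine finsum_eq_of_bijective (fun x => ⟨flag x.1, rfl, ?_, ?_, ?_⟩) ⟨?_, ?_⟩ ?_
  · rintro (_ | _ | j) <;> simp [flag]
  · rintro (_ | _ | j)
    · exact finrank_top F _ |>.trans (by simp)
    · exact finrank_line x.1
    · exact finrank_bot F _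
  · rintro (_ | _ | j) v hv
    · trivial
    · simp only [flag, zero_add, one_ne_zero, if_true, if_false] at hv ⊢
      rw [forall_mem_line x.2 v hv]
      exact Submodule.smul_mem _ _ hv
    · simp_all [flag]
  · intro x y h
    have := congr_fun (congr_arg Subtype.val h) 1
    exact Subtype.ext (line_injective this)
  · rintro ⟨V, h0, hle, hrank, hst⟩
    obtain ⟨x, hx⟩ := exists_line_eq (V 1) (hrank 1)
    have hmem : pointVec x ∈ V 1 := hx ▸ Submodule.mem_span_singleton_self _
    have hg := hst 1 _ hmem
    rw [← hx] at hg
    obtain ⟨c, hc⟩ := Submodule.mem_span_singleton.1 hg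
    refine ⟨⟨x, smul_eq_self_of_smul_pointVec (c := c) hc.symm⟩, Subtype.ext ?_⟩
    funext j
    match j with
    | 0 => exact h0.symm
    | 1 => exact hx
    | j + 2 => exact (Submodule.finrank_eq_zero.1 (hrank (j + 2))).symm
  · rintro ⟨x, hx⟩
    have h1 := quotDet_bot_of_forall_eq_smul _ _ _ (finrank_line x) (forall_mem_line hx)
    have h2 := mul_quotDet_top_of_forall_eq_smul _ _ _ (finrank_line x) (forall_mem_line hx)
    rw [← Matrix.toLin'_apply', LinearMap.det_toLin', mul_comm, ← eq_div_iff (eig_ne_zero hx)] at h2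
    rw [← Matrix.toLin'_apply'] at h1
    simp [Finset.prod_range_succ, lineWeight, flag, h1, h2, ← Matrix.toLin'_apply']

theorem upper_smul_infty (a d : Fˣ) (b : F) : upper a d b • (∞ : OnePoint F) = ∞ := by
  rw [OnePoint.smul_infty_eq_self_iff, coe_upper]
  simp

theorem upper_smul_coe_eq_iff (a d : Fˣ) (b t : F) :
    upper a d b • (t : OnePoint F) = t ↔ a * t + b = t * d := by
  rw [OnePoint.smul_some_eq_ite, coe_upper]
  simp [div_eq_iff]

theorem sum_stabilizer_infty [Fintype F] (f : GL (Fin 2) F → ℂ) :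
    (∑ g, if g • (∞ : OnePoint F) = ∞ then f g else 0) =
      ∑ a : Fˣ, ∑ d : Fˣ, ∑ b : F, f (upper a d b) := by
  simp_rw [← Fintype.sum_prod_type']
  rw [← Finset.sum_filter, eq_comm]
  refine Finset.sum_bij (fun p _ => upper p.1 p.2.1 p.2.2) ?_ ?_ ?_ fun _ _ => rfl
  · intro p _
    simp [upper_smul_infty]
  · rintro ⟨a, d, b⟩ _ ⟨a', d', b'⟩ _ h
    have h' := congr_arg (fun g : GL (Fin 2) F => (g : Matrix (Fin 2) (Fin 2) F)) h
    simp only [coe_upper] at h'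
    have h00 := congr_fun (congr_fun h' 0) 0
    have h01 := congr_fun (congr_fun h' 0) 1
    have h11 := congr_fun (congr_fun h' 1) 1
    simp only [Matrix.of_apply, Matrix.cons_val_zero, Matrix.cons_val_one, Units.val_inj]
      at h00 h01 h11
    simp_all
  · intro g hg
    have h10 : g 1 0 = 0 := OnePoint.smul_infty_eq_self_iff.1 (Finset.mem_filter.1 hg).2
    have hdet := g.det_ne_zero
    rw [Matrix.det_fin_two, h10, mul_zero, sub_zero, mul_ne_zero_iff] at hdet
    refine ⟨(Units.mk0 _ hdet.1, Units.mk0 _ hdet.2, g 0 1), Finset.mem_univ _, ?_⟩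
    ext i j
    fin_cases i <;> fin_cases j <;> simp [coe_upper, h10]

/-- The number of fixed points of an upper triangular matrix on the affine line. -/
def affineFix [Fintype F] (a d : Fˣ) (b : F) : ℕ :=
  (Finset.univ.filter fun t : F => a * t + b = t * d).card

theorem affineFix_of_ne [Fintype F] {a d : Fˣ} (h : d ≠ a) (b : F) : affineFix a d b = 1 := by
  have h' : (d : F) - a ≠ 0 := sub_ne_zero.2 fun e => h (Units.ext e)
  rw [affineFix, Finset.card_eq_one]
  refine ⟨b / (d - a), Finset.ext fun t => ?_⟩
  rw [Finset.mem_filter, Finset.mem_singleton, eq_div_iff h']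
  constructor
  · rintro ⟨-, h⟩
    linear_combination -h
  · intro h
    exact ⟨Finset.mem_univ _, by linear_combination -h⟩

theorem affineFix_self [Fintype F] (a : Fˣ) (b : F) :
    affineFix a a b = if b = 0 then Fintype.card F else 0 := by
  have : ∀ t : F, a * t + b = t * a ↔ b = 0 := fun t => by rw [mul_comm, add_eq_left]
  simp only [affineFix, this]
  split_ifs with h <;> simp [h]

theorem card_fixed_upper [Fintype F] (a d : Fˣ) (b : F) :
    ((Finset.univ.filter fun x : OnePoint F => upper a d b • x = x).card : ℂ) =
      1 + affineFix a d b := by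
  rw [Finset.card_filter, Nat.cast_sum, sum_onePoint, if_pos (upper_smul_infty a d b)]
  simp [upper_smul_coe_eq_iff, affineFix]

theorem sum_lineWeight_upper [Fintype F] (δ : Fˣ →* ℂˣ) (a d : Fˣ) (b : F) :
    (∑ x : OnePoint F, if upper a d b • x = x then lineWeight δ (upper a d b) x else 0) =
      δ (d / a) + affineFix a d b * ((δ (d / a))⁻¹ : ℂˣ) := by
  rw [sum_onePoint, if_pos (upper_smul_infty a d b), lineWeight_upper_infty]
  simp only [lineWeight_upper_coe, upper_smul_coe_eq_iff]
  rw [← Finset.sum_filter, Finset.sum_const, nsmul_eq_mul, affineFix]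

theorem sum_lineWeight_conj [Fintype F] (δ : Fˣ →* ℂˣ) (h g : GL (Fin 2) F) :
    (∑ x : OnePoint F, if (h * g * h⁻¹) • x = x then lineWeight δ (h * g * h⁻¹) x else 0) =
      ∑ x : OnePoint F, if g • x = x then lineWeight δ g x else 0 := by
  refine (Fintype.sum_equiv (MulAction.toPerm h) _ _ fun x => ?_).symm
  rw [MulAction.toPerm_apply]
  simp only [conj_smul_smul_eq_iff]
  split_ifs with hx
  · have hdet : ((h * g * h⁻¹ : GL (Fin 2) F) : Matrix (Fin 2) (Fin 2) F).det =
        (g : Matrix (Fin 2) (Fin 2) F).det := by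
      rw [Units.val_mul, Units.val_mul, Matrix.det_units_conj]
    rw [lineWeight, lineWeight, eig_conj h hx, hdet]
  · rfl

instance : MulAction.IsPretransitive (GL (Fin 2) F) (OnePoint F) := by
  refine MulAction.IsPretransitive.of_orbit (x₀ := ∞) fun x => ?_
  cases x with
  | infty => exact ⟨1, one_smul _ _⟩
  | coe t =>
    refine ⟨Matrix.GeneralLinearGroup.mkOfDetNeZero !![t, 1; 1, 0] (by simp), ?_⟩
    rw [OnePoint.smul_infty_eq_ite]
    simp [Matrix.GeneralLinearGroup.mkOfDetNeZero]

theorem sum_sum_div {G : Type} [Group G] [Fintype G] (f : G → ℂ) :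
    ∑ a : G, ∑ d : G, f (d / a) = Fintype.card G * ∑ c, f c := by
  rw [Fintype.card, ← nsmul_eq_mul, ← Finset.sum_const]
  exact Finset.sum_congr rfl fun a _ => Fintype.sum_equiv (Equiv.divRight a) _ _ fun _ => rfl

/-- The sum over the unipotent radical of the class function divided by the number of
fixed points. -/
theorem sum_prod_div_affineFix [Fintype F] {k : ℕ} (hk : 1 ≤ k) (δ : Fin k → (Fˣ →* ℂˣ))
    (a d : Fˣ) :
    (∑ b : F, (∏ i, ((δ i (d / a) : ℂ) + affineFix a d b * ((δ i (d / a))⁻¹ : ℂˣ))) /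
        (1 + affineFix a d b)) =
      (Fintype.card F : ℂ) / 2 * (∏ i, ((δ i (d / a) : ℂ) + ((δ i (d / a))⁻¹ : ℂˣ))) +
        if d / a = 1 then ((Fintype.card F : ℂ) + 1) ^ (k - 1) + ((Fintype.card F : ℂ) - 1) -
            2 ^ (k - 1) * (Fintype.card F : ℂ) else 0 := by
  obtain ⟨k, rfl⟩ := Nat.exists_eq_add_of_le' hk
  by_cases h : d = a
  · subst h
    have hq : (1 + Fintype.card F : ℂ) ≠ 0 := by
      rw [add_comm]
      exact Nat.cast_add_one_ne_zero _
    simp only [div_self', map_one, inv_one, Units.val_one, mul_one, Finset.prod_const,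
      Finset.card_univ, Fintype.card_fin, affineFix_self, if_true, Nat.add_sub_cancel]
    rw [← Finset.add_sum_erase _ _ (Finset.mem_univ (0 : F)), Finset.sum_congr rfl
      (g := fun _ => (1 : ℂ)) fun b hb => by rw [if_neg (Finset.ne_of_mem_erase hb)]; simp]
    rw [if_pos rfl, pow_succ, mul_div_cancel_right₀ _ hq, Finset.sum_const,
      Finset.card_erase_of_mem (Finset.mem_univ _), Finset.card_univ, nsmul_eq_mul, mul_one,
      Nat.cast_sub Fintype.card_pos]
    push_cast
    ring
  · simp only [affineFix_of_ne h, div_eq_one, h, if_false, Nat.cast_one, one_mul, add_zero,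
      Finset.sum_const, Finset.card_univ, nsmul_eq_mul]
    ring

end DecEq

end QRep

open QRep in
/-- For characters `δ_1, …, δ_k : 𝔽_q^× → ℂ^×` with `δ_i^2 ≠ 1`, and
`R_i = R(δ_i, δ_i^{-1})` the Harish-Chandra induced characters of the diagonal torus of
`GL_2(𝔽_q)`,
`(1/|GL_2(𝔽_q)|) Σ_g ∏_i R_i(g) = ((q+1)^{k-1} + (q-1) - 2^{k-1} q)/(q(q-1)) + N/2`,
where `N = #{A ⊆ {1,…,k} : ∏_{j∈A} δ_j = ∏_{h∉A} δ_h}`. -/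
theorem statement13 (F : Type) [Field F] [Fintype F] (k : ℕ) (hk : 1 ≤ k)
    (δ : Fin k → (Fˣ →* ℂˣ)) (hδ : ∀ i, (δ i) ^ 2 ≠ 1) :
    (Nat.card (GL (Fin 2) F) : ℂ)⁻¹ *
        ∑ᶠ g : GL (Fin 2) F,
          ∏ i : Fin k,
            HC F 2 1 (fun j => if j = 0 then 2 else if j = 1 then 1 else 0)
              (fun j => if j = 0 then δ i else (δ i)⁻¹) g =
      (((Fintype.card F : ℂ) + 1) ^ (k - 1) + ((Fintype.card F : ℂ) - 1) -
            2 ^ (k - 1) * (Fintype.card F : ℂ)) /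
          ((Fintype.card F : ℂ) * ((Fintype.card F : ℂ) - 1)) +
        (Nat.card {A : Finset (Fin k) // ∏ j ∈ A, δ j = ∏ h ∈ Aᶜ, δ h} : ℂ) / 2 := by
  classical
  have hq0 : (Fintype.card F : ℂ) ≠ 0 := Nat.cast_ne_zero.2 Fintype.card_ne_zero
  have hq1 : (Fintype.card F : ℂ) - 1 ≠ 0 :=
    sub_ne_zero.2 (Nat.cast_ne_one.2 Fintype.one_lt_card.ne')
  have hq2 : (Fintype.card F : ℂ) + 1 ≠ 0 := Nat.cast_add_one_ne_zero _
  simp only [HC_eq_sum_s13]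
  rw [finsum_eq_sum_of_fintype, sum_eq_card_mul_sum_stabilizer (OnePoint.infty : OnePoint F),
    sum_stabilizer_infty]
  · simp only [sum_lineWeight_upper, card_fixed_upper, sum_prod_div_affineFix hk]
    rw [sum_sum_div (fun c => (Fintype.card F : ℂ) / 2 *
      (∏ i, ((δ i c : ℂ) + ((δ i c)⁻¹ : ℂˣ))) + if c = 1 then _ else 0),
      Finset.sum_add_distrib, ← Finset.mul_sum, sum_units_prod_add_inv, Finset.sum_ite_eq',
      if_pos (Finset.mem_univ _), card_onePoint, card_GL_two, Fintype.card_units,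
      Nat.cast_sub Fintype.card_pos]
    push_cast
    field_simp
    ring
  · intro h g
    simp only [sum_lineWeight_conj]
  · intro g hg
    exact Finset.prod_eq_zero (Finset.mem_univ ⟨0, hk⟩) (by simp [hg])
end

section
/- For every prime power q and every n ≥ 0, the number of similarity classes (conjugacy classes under GL_n(𝔽_q)) of matrices in Mat_n(𝔽_q) that are diagonalizable over an algebraic closure 𝔽̄_q (equivalently, whose minimal polynomial is squarefree) equals q^n. -/
open Matrix
open Polynomial UniqueFactorizationMonoid

/-- The characteristic polynomial of a finite direct sum of endomorphisms is the product of the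
characteristic polynomials. -/
theorem LinearMap.charpoly_piMap {R : Type*} [CommRing R] {k : ℕ} {M : Fin k → Type*}
    [∀ i, AddCommGroup (M i)] [∀ i, Module R (M i)] [∀ i, Module.Free R (M i)]
    [∀ i, Module.Finite R (M i)] (f : ∀ i, Module.End R (M i)) :
    (LinearMap.piMap f).charpoly = ∏ i, (f i).charpoly := by
  induction k with
  | zero =>
    nontriviality R
    rw [Fin.prod_univ_zero]
    refine (LinearMap.charpoly_monic _).natDegree_eq_zero.mp ?_
    rw [LinearMap.charpoly_natDegree, Module.finrank_zero_of_subsingleton]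
  | succ k ih =>
    rw [Fin.prod_univ_succ, ← ih fun i => f i.succ, ← LinearMap.charpoly_prodMap,
      ← LinearEquiv.charpoly_conj (Fin.consLinearEquiv R M)]
    congr 1
    refine LinearMap.ext fun v => funext fun i => ?_
    cases i using Fin.cases <;>
      simp [LinearEquiv.conj_apply, Fin.consLinearEquiv, Fin.consEquiv, Fin.tail]

theorem LinearMap.charpoly_mulLeft_root {F : Type*} [Field F] {p : F[X]}
    [Module.Finite F (AdjoinRoot p)] (hp : p.Monic) :
    (LinearMap.mulLeft F (AdjoinRoot.root p)).charpoly = p := by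
  have h := charpoly_leftMulMatrix (AdjoinRoot.powerBasis hp.ne_zero)
  rwa [AdjoinRoot.minpoly_powerBasis_gen_of_monic hp, Algebra.leftMulMatrix_apply,
    LinearMap.charpoly_toMatrix, AdjoinRoot.powerBasis_gen] at h

/-- Multiplication by the tuple of adjoined roots on a product of algebras `F[X] ⧸ (p i)`. -/
noncomputable def rootsMul {F ι : Type*} [Field F] (p : ι → F[X]) :
    Module.End F (Π i, AdjoinRoot (p i)) :=
  LinearMap.piMap fun i => LinearMap.mulLeft F (AdjoinRoot.root (p i))

theorem rootsMul_apply {F ι : Type*} [Field F] (p : ι → F[X]) (v : Π i, AdjoinRoot (p i)) (i : ι) :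
    rootsMul p v i = AdjoinRoot.root (p i) * v i := rfl

theorem charpoly_rootsMul {F : Type*} [Field F] {k : ℕ} (p : Fin k → F[X])
    [∀ i, Module.Finite F (AdjoinRoot (p i))] (hp : ∀ i, (p i).Monic) :
    (rootsMul p).charpoly = ∏ i, p i := by
  rw [rootsMul, LinearMap.charpoly_piMap]
  exact Finset.prod_congr rfl fun i _ => LinearMap.charpoly_mulLeft_root (hp i)

theorem aeval_rootsMul_apply {F ι : Type*} [Field F] (p : ι → F[X]) (g : F[X])
    (v : Π i, AdjoinRoot (p i)) (i : ι) :
    aeval (rootsMul p) g v i = AdjoinRoot.mk (p i) g * v i := by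
  induction g using Polynomial.induction_on' with
  | add a b ha hb => simp [ha, hb, add_mul]
  | monomial m c =>
    rw [aeval_monomial]
    have h_pow (m : ℕ) : ((rootsMul p) ^ m) v i = AdjoinRoot.root (p i) ^ m * v i := by
      induction m with
      | zero => simp
      | succ m ih => rw [pow_succ', Module.End.mul_apply, rootsMul_apply, ih]; ring
    rw [Module.End.mul_apply, Module.algebraMap_end_apply, Pi.smul_apply, h_pow,
      ← C_mul_X_pow_eq_monomial, map_mul, map_pow, AdjoinRoot.mk_C, AdjoinRoot.mk_X, mul_assoc,
      Algebra.smul_def, AdjoinRoot.algebraMap_eq]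

theorem map_univ_eq_normalizedFactors_prod {F ι : Type*} [Field F] [DecidableEq F] [Fintype ι]
    (p : ι → F[X]) (hp : ∀ i, (p i).Monic) (hp' : ∀ i, Irreducible (p i)) :
    Finset.univ.val.map p = normalizedFactors (∏ i, p i) := by
  rw [Finset.prod, normalizedFactors_prod_eq (Finset.univ.val.map p) (by simpa using hp'),
    Multiset.map_map]
  exact Multiset.map_congr rfl fun i _ => (hp i).normalize_eq_self.symm

/-- Unique factorization for families of monic irreducible polynomials. -/
theorem exists_equiv_comp_eq_of_prod_eq {F ι κ : Type*} [Field F] [Fintype ι] [Fintype κ]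
    {p : ι → F[X]} {q : κ → F[X]} (hp : ∀ i, (p i).Monic) (hp' : ∀ i, Irreducible (p i))
    (hq : ∀ i, (q i).Monic) (hq' : ∀ i, Irreducible (q i)) (h : ∏ i, p i = ∏ j, q j) :
    ∃ σ : ι ≃ κ, q ∘ σ = p := by
  classical
  have h_map : Finset.univ.val.map p = Finset.univ.val.map q := by
    rw [map_univ_eq_normalizedFactors_prod p hp hp', map_univ_eq_normalizedFactors_prod q hq hq', h]
  have h_fiber (c : F[X]) : Nonempty ({i // p i = c} ≃ {j // q j = c}) := by
    have h_count := congrArg (Multiset.count c) h_map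
    rw [Multiset.count_map, Multiset.count_map] at h_count
    refine ⟨Fintype.equivOfCardEq ?_⟩
    simp_rw [Fintype.card_subtype, Finset.card, Finset.filter_val, eq_comm (b := c)]
    exact h_count
  exact ⟨Equiv.ofFiberEquiv fun c => (h_fiber c).some, funext fun i => Equiv.ofFiberEquiv_map _ _⟩

/-- An endomorphism with squarefree minimal polynomial is isomorphic to multiplication by `X` on a
product of simple quotients of `F[X]`. -/
theorem exists_linearEquiv_rootsMul {F V : Type*} [Field F] [AddCommGroup V] [Module F V]
    [FiniteDimensional F V] (f : Module.End F V) (hf : Squarefree (minpoly F f)) :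
    ∃ (k : ℕ) (p : Fin k → F[X]), (∀ i, (p i).Monic) ∧ (∀ i, Irreducible (p i)) ∧
      ∃ e : V ≃ₗ[F] Π i, AdjoinRoot (p i), ∀ v, e (f v) = rootsMul p (e v) := by
  classical
  have : IsSemisimpleModule F[X] (Module.AEval' f) :=
    Module.End.isSemisimple_of_squarefree_aeval_eq_zero hf (minpoly.aeval F f)
  obtain ⟨k, S, e, hS⟩ := IsSemisimpleModule.exists_linearEquiv_fin_dfinsupp F[X] (Module.AEval' f)
  have h_quot (i : Fin k) : ∃ p : F[X], p.Monic ∧ Irreducible p ∧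
      Nonempty (S i ≃ₗ[F[X]] F[X] ⧸ Ideal.span {p}) := by
    obtain ⟨I, hI, ⟨e'⟩⟩ := isSimpleModule_iff_quot_maximal.mp (hS i)
    obtain ⟨a, ha⟩ := (inferInstance : I.IsPrincipal).principal
    have h_mem : minpoly F f ∈ I := by
      have h_smul (s : S i) : minpoly F f • s = 0 := by
        apply Subtype.ext
        obtain ⟨v, hv⟩ := (Module.AEval'.of f).surjective s.1
        rw [Submodule.coe_smul, ← hv, ← Module.AEval.of_aeval_smul, minpoly.aeval]
        simp
      have h_one := h_smul (e'.symm (Ideal.Quotient.mk I 1))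
      rw [← map_smul, EmbeddingLike.map_eq_zero_iff] at h_one
      rw [← Ideal.Quotient.eq_zero_iff_mem, ← mul_one (minpoly F f)]
      exact h_one
    have ha0 : a ≠ 0 := by
      rintro rfl
      rw [ha, Submodule.span_zero_singleton, Submodule.mem_bot] at h_mem
      exact hf.ne_zero h_mem
    have h_span : I = Ideal.span {normalize a} := by
      rw [ha, Ideal.submodule_span_eq, Ideal.span_singleton_eq_span_singleton]
      exact associated_normalize a
    refine ⟨normalize a, monic_normalize ha0, ?_, ⟨h_span ▸ e'⟩⟩
    rw [h_span] at hI
    exact ((Ideal.span_singleton_prime (by simpa using ha0)).mp hI.isPrime).irreducible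
  choose p hp hp' e' using h_quot
  let E : Module.AEval' f ≃ₗ[F[X]] Π i, F[X] ⧸ Ideal.span {p i} :=
    e.trans ((DFinsupp.linearEquivFunOnFintype).trans
      (LinearEquiv.piCongrRight fun i => (e' i).some))
  refine ⟨k, p, hp, hp', (Module.AEval'.of f).trans (E.restrictScalars F), fun v => ?_⟩
  funext i
  have h_X := congrFun (E.map_smul X (Module.AEval'.of f v)) i
  rw [Module.AEval'.X_smul_of] at h_X
  exact h_X

theorem exists_linearEquiv_of_charpoly_eq {F V W : Type*} [Field F] [AddCommGroup V] [Module F V]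
    [FiniteDimensional F V] [AddCommGroup W] [Module F W] [FiniteDimensional F W]
    (f : Module.End F V) (g : Module.End F W) (hf : Squarefree (minpoly F f))
    (hg : Squarefree (minpoly F g)) (h : f.charpoly = g.charpoly) :
    ∃ e : V ≃ₗ[F] W, ∀ v, e (f v) = g (e v) := by
  obtain ⟨k, p, hp, hp', e, he⟩ := exists_linearEquiv_rootsMul f hf
  obtain ⟨l, q, hq, hq', e', he'⟩ := exists_linearEquiv_rootsMul g hg
  have (i : Fin k) : Module.Finite F (AdjoinRoot (p i)) := (hp i).finite_adjoinRoot
  have (i : Fin l) : Module.Finite F (AdjoinRoot (q i)) := (hq i).finite_adjoinRoot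
  have h_f : f.charpoly = ∏ i, p i := by
    rw [← charpoly_rootsMul p hp, ← LinearEquiv.charpoly_conj e f]
    congr 1
    refine LinearMap.ext fun v => ?_
    simp [LinearEquiv.conj_apply, he]
  have h_g : g.charpoly = ∏ i, q i := by
    rw [← charpoly_rootsMul q hq, ← LinearEquiv.charpoly_conj e' g]
    congr 1
    refine LinearMap.ext fun v => ?_
    simp [LinearEquiv.conj_apply, he']
  obtain ⟨σ, rfl⟩ := exists_equiv_comp_eq_of_prod_eq hp hp' hq hq' (by rw [← h_f, h, h_g])
  let c : (Π i, AdjoinRoot (q (σ i))) ≃ₗ[F] Π j, AdjoinRoot (q j) :=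
    LinearEquiv.piCongrLeft F (fun j => AdjoinRoot (q j)) σ
  have hc (v : Π i, AdjoinRoot (q (σ i))) (i : Fin k) : c v (σ i) = v i :=
    Equiv.piCongrLeft_apply_apply (fun j => AdjoinRoot (q j)) σ v i
  refine ⟨(e.trans c).trans e'.symm, fun v => ?_⟩
  apply e'.injective
  rw [he']
  simp only [LinearEquiv.trans_apply, LinearEquiv.apply_symm_apply]
  funext j
  obtain ⟨i, rfl⟩ := σ.surjective j
  rw [rootsMul_apply, hc, he, hc]
  rfl

/-- Every monic polynomial of degree `n` is the characteristic polynomial of an `n × n` matrix with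
squarefree minimal polynomial. -/
theorem exists_matrix_charpoly_eq {F : Type*} [Field F] {n : ℕ} {P : F[X]} (hP : P.Monic)
    (hn : P.natDegree = n) :
    ∃ A : Matrix (Fin n) (Fin n) F, Squarefree (minpoly F A) ∧ A.charpoly = P := by
  classical
  set L := (normalizedFactors P).toList with hL
  let p : Fin L.length → F[X] := fun i => L.get i
  have h_factor (i : Fin L.length) : Irreducible (p i) ∧ (p i).Monic ∧ p i ∣ P :=
    (Polynomial.mem_normalizedFactors_iff hP.ne_zero).mp
      (Multiset.mem_toList.mp (List.get_mem L i))
  have (i : Fin L.length) : Module.Finite F (AdjoinRoot (p i)) :=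
    (h_factor i).2.1.finite_adjoinRoot
  have h_prod : ∏ i, p i = P := by
    rw [← List.prod_ofFn, List.ofFn_get, hL, Multiset.prod_toList,
      prod_normalizedFactors_eq hP.ne_zero, hP.normalize_eq_self]
  have h_char : (rootsMul p).charpoly = P :=
    (charpoly_rootsMul p fun i => (h_factor i).2.1).trans h_prod
  have h_dim : Module.finrank F (Π i, AdjoinRoot (p i)) = n := by
    rw [← LinearMap.charpoly_natDegree (rootsMul p), h_char, hn]
  let b := Module.finBasisOfFinrankEq F (Π i, AdjoinRoot (p i)) h_dim
  refine ⟨LinearMap.toMatrix b b (rootsMul p), ?_, ?_⟩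
  · rw [LinearMap.minpoly_toMatrix]
    refine (squarefree_radical (a := P)).squarefree_of_dvd (minpoly.dvd F _ ?_)
    refine LinearMap.ext fun v => funext fun i => ?_
    rw [aeval_rootsMul_apply, AdjoinRoot.mk_eq_zero.mpr, zero_mul]
    · rfl
    · exact (dvd_radical_iff_of_irreducible (h_factor i).1 hP.ne_zero).mpr (h_factor i).2.2
  · rw [LinearMap.charpoly_toMatrix, h_char]

theorem exists_conj_of_charpoly_eq {F ι : Type*} [Field F] [Fintype ι] [DecidableEq ι]
    (A B : Matrix ι ι F) (hA : Squarefree (minpoly F A)) (hB : Squarefree (minpoly F B))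
    (h : A.charpoly = B.charpoly) :
    ∃ P : GL ι F, B = (P : Matrix ι ι F) * A * ((P⁻¹ : GL ι F) : Matrix ι ι F) := by
  obtain ⟨e, he⟩ := exists_linearEquiv_of_charpoly_eq (toLin' A) (toLin' B)
    (by rwa [minpoly_toLin']) (by rwa [minpoly_toLin'])
    (by rw [charpoly_toLin', charpoly_toLin', h])
  let P : GL ι F :=
    ⟨LinearMap.toMatrix' e.toLinearMap, LinearMap.toMatrix' e.symm.toLinearMap,
      by rw [← LinearMap.toMatrix'_comp]; simp, by rw [← LinearMap.toMatrix'_comp]; simp⟩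
  have hP : (P : Matrix ι ι F) * A = B * P := by
    apply toLin'.injective
    refine LinearMap.ext fun v => ?_
    simpa [P, toLin'_mul] using he v
  exact ⟨P, by rw [hP, mul_assoc, Units.mul_inv, mul_one]⟩

theorem natCard_monic_natDegree_eq (F : Type*) [Field F] [Fintype F] (n : ℕ) :
    Nat.card {p : F[X] // p.Monic ∧ p.natDegree = n} = Fintype.card F ^ n := by
  rw [Nat.card_congr ((monicEquivDegreeLT n).trans (degreeLTEquiv F n).toEquiv)]
  simp

/-- The number of similarity classes of semisimple matrices in
`Mat_n(𝔽_q)` (i.e. matrices diagonalizable over `𝔽̄_q`, equivalently with squarefree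
minimal polynomial) equals `q^n`. -/
theorem statement14 (F : Type) [Field F] [Fintype F] (n : ℕ) :
    Nat.card (Quot fun A B : {M : Matrix (Fin n) (Fin n) F // Squarefree (minpoly F M)} =>
      ∃ P : GL (Fin n) F,
        B.1 = (P : Matrix (Fin n) (Fin n) F) * A.1 *
          ((P⁻¹ : GL (Fin n) F) : Matrix (Fin n) (Fin n) F)) = Fintype.card F ^ n := by
  rw [← natCard_monic_natDegree_eq F n]
  refine Nat.card_congr (Equiv.ofBijective (Quot.lift
    (fun A => ⟨A.1.charpoly, A.1.charpoly_monic, by simp [charpoly_natDegree_eq_dim]⟩) ?_) ⟨?_, ?_⟩)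
  · rintro A B ⟨P, hP⟩
    simp only [hP, coe_units_inv, charpoly_units_conj]
  · rintro ⟨A⟩ ⟨B⟩ h
    exact Quot.sound (exists_conj_of_charpoly_eq A.1 B.1 A.2 B.2 (congrArg Subtype.val h))
  · rintro ⟨P, hP, hn⟩
    obtain ⟨A, hA, h_char⟩ := exists_matrix_charpoly_eq hP hn
    exact ⟨Quot.mk _ ⟨A, hA⟩, Subtype.ext h_char⟩
end
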